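/- arXiv:1410.3149 — 2 statements merged into one kernel-verified Lean document; each statement's English description precedes it below -/
import Mathlib

section
/- Fix a positive integer n. The image of the Gelfand–Zeitlin map L_B : B → ℝ^∇ is exactly the Gelfand–Zeitlin cone Δ_GZ: for every A ∈ B the tableau L_B(A) satisfies the interlacing inequalities defining Δ_GZ, and conversely every tableau Ξ ∈ Δ_GZ equals L_B(A) for some A ∈ B. -/
open Matrix

/-- The eigenvalues of a Hermitian matrix, listed in decreasing order:
`eigsDesc hA 0 = λ₁ ≥ eigsDesc hA 1 = λ₂ ≥ …`. -/
noncomputable def eigsDesc {n : ℕ} {A : Matrix (Fin n) (Fin n) ℂ} (hA : A.IsHermitian) :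
    Fin n → ℝ :=
  fun i => hA.eigenvalues (Tuple.sort hA.eigenvalues i.rev)
/-- `lMap hA i = λ₁ + … + λ_{i+1}`, the partial sums of the decreasingly ordered
eigenvalues of a Hermitian matrix (`i : Fin n` represents the index `i+1`). -/
noncomputable def lMap {n : ℕ} {A : Matrix (Fin n) (Fin n) ℂ} (hA : A.IsHermitian) :
    Fin n → ℝ :=
  fun i => ∑ j ∈ Finset.Iic i, eigsDesc hA j


/-- The set `B` of upper-triangular complex matrices with positive real diagonal
entries. -/
def UpperTriPos (n : ℕ) : Set (Matrix (Fin n) (Fin n) ℂ) :=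
  {A | (∀ i j : Fin n, j < i → A i j = 0) ∧ ∀ i : Fin n, 0 < (A i i).re ∧ (A i i).im = 0}

/-- `lB A i = (1/2)(log λ₁(AA*) + … + log λ_{i+1}(AA*))`, where the `λ`'s are the
decreasingly ordered eigenvalues of `A * Aᴴ` (`i : Fin n` represents the index `i+1`). -/
noncomputable def lB {n : ℕ} (A : Matrix (Fin n) (Fin n) ℂ) : Fin n → ℝ :=
  fun i => (1 / 2) * ∑ j ∈ Finset.Iic i,
    Real.log (eigsDesc (Matrix.isHermitian_mul_conjTranspose_self A) j)

/-- The multiplicative Horn cone: triples `(r, s, t)` such that there exist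
`A, C ∈ B` with `lB A = r`, `lB C = s`, `lB (A * C) = t`. -/
def HornConeB (n : ℕ) : Set ((Fin n → ℝ) × (Fin n → ℝ) × (Fin n → ℝ)) :=
  {rst | ∃ A C : Matrix (Fin n) (Fin n) ℂ, A ∈ UpperTriPos n ∧ C ∈ UpperTriPos n ∧
    lB A = rst.1 ∧ lB C = rst.2.1 ∧ lB (A * C) = rst.2.2}

/-- The `(k, i)` entry of the Gelfand–Zeitlin tableau `L_B(A)` of an upper-triangular
matrix: `lBᵢ(A^{(k)})` for `1 ≤ i ≤ k ≤ n` (where `A^{(k)}` is the top-left `k × k`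
principal submatrix) and `0` otherwise; in particular `lᵏ₀ = 0`. -/
noncomputable def LBtab {n : ℕ} (A : Matrix (Fin n) (Fin n) ℂ) (k i : ℕ) : ℝ :=
  if h : 1 ≤ i ∧ i ≤ k ∧ k ≤ n then
    lB (A.submatrix (Fin.castLE h.2.2) (Fin.castLE h.2.2)) ⟨i - 1, by omega⟩
  else 0

/-- Membership in the Gelfand–Zeitlin cone `Δ_GZ` for a triangular tableau of size
`n`, encoded as a function `f : ℕ → ℕ → ℝ` (`f k i` is the entry `lᵏᵢ`): the entries
`lᵏ₀` vanish and the interlacing inequalities hold for `1 ≤ i ≤ k < n`. -/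
def IsGZTableau (n : ℕ) (f : ℕ → ℕ → ℝ) : Prop :=
  (∀ k ≤ n, f k 0 = 0) ∧
  ∀ k i : ℕ, 1 ≤ i → i ≤ k → k < n →
    f (k + 1) i + f k (i - 1) ≥ f (k + 1) (i - 1) + f k i ∧
    f (k + 1) i + f k i ≥ f (k + 1) (i + 1) + f k (i - 1)

open Polynomial in
lemma eigsDesc_charpoly {n : ℕ} {A : Matrix (Fin n) (Fin n) ℂ} (hA : A.IsHermitian) :
    A.charpoly = ∏ i, (X - C ((eigsDesc hA i : ℝ) : ℂ)) := by
  rw [hA.charpoly_eq]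
  exact (Equiv.prod_comp (Fin.revPerm.trans (Tuple.sort hA.eigenvalues))
    (fun i => (X - C ((hA.eigenvalues i : ℝ) : ℂ)))).symm

lemma eigsDesc_antitone {n : ℕ} {A : Matrix (Fin n) (Fin n) ℂ} (hA : A.IsHermitian) :
    Antitone (eigsDesc hA) := by
  intro i j hij
  exact Tuple.monotone_sort hA.eigenvalues (Fin.rev_le_rev.2 hij)

open Polynomial in
lemma antitone_unique {n : ℕ} {f g : Fin n → ℝ} (hf : Antitone f) (hg : Antitone g)
    (h : ∏ i, (X - C ((f i : ℝ) : ℂ)) = ∏ i, (X - C ((g i : ℝ) : ℂ))) : f = g := by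
  have h1 : ∀ f : Fin n → ℝ, (∏ i, (X - C ((f i : ℝ) : ℂ))).roots.map Complex.re
      = (List.ofFn f : Multiset ℝ) := by
    intro f
    rw [Polynomial.roots_prod]
    · simp [Fin.univ_val_map, Function.comp_def]
    · simp [Finset.prod_ne_zero_iff, Polynomial.X_sub_C_ne_zero]
  have h2 : (List.ofFn f : Multiset ℝ) = List.ofFn g := by rw [← h1, ← h1, h]
  exact List.ofFn_inj.1 ((Multiset.coe_eq_coe.1 h2).eq_of_sortedGE hf.sortedGE_ofFn hg.sortedGE_ofFn)

open Polynomial in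
lemma eigsDesc_eq {n : ℕ} {A : Matrix (Fin n) (Fin n) ℂ} (hA : A.IsHermitian) {f : Fin n → ℝ}
    (hf : Antitone f) (h : A.charpoly = ∏ i, (X - C ((f i : ℝ) : ℂ))) : eigsDesc hA = f :=
  antitone_unique (eigsDesc_antitone hA) hf (by rw [← eigsDesc_charpoly, h])

lemma eigsDesc_congr {n : ℕ} {A B : Matrix (Fin n) (Fin n) ℂ} (hA : A.IsHermitian)
    (hB : B.IsHermitian) (h : A.charpoly = B.charpoly) : eigsDesc hA = eigsDesc hB :=
  eigsDesc_eq hA (eigsDesc_antitone hB) (by rw [h, eigsDesc_charpoly hB])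

lemma eigsDesc_diag {n : ℕ} {A : Matrix (Fin n) (Fin n) ℂ} (hA : A.IsHermitian) :
    ∃ U : Matrix (Fin n) (Fin n) ℂ, Uᴴ * U = 1 ∧ U * Uᴴ = 1 ∧
      Uᴴ * A * U = diagonal (fun i => ((eigsDesc hA i : ℝ) : ℂ)) := by
  set σ : Equiv.Perm (Fin n) := Fin.revPerm.trans (Tuple.sort hA.eigenvalues) with hσ
  set V : Matrix (Fin n) (Fin n) ℂ := (hA.eigenvectorUnitary : Matrix (Fin n) (Fin n) ℂ) with hV
  have h1 : Vᴴ * V = 1 := by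
    rw [← star_eq_conjTranspose]; exact Unitary.coe_star_mul_self hA.eigenvectorUnitary
  have h3 : Vᴴ * A * V = diagonal (RCLike.ofReal ∘ hA.eigenvalues) := by
    have := hA.conjStarAlgAut_star_eigenvectorUnitary
    rw [Unitary.conjStarAlgAut_star_apply] at this
    exact this
  have h4 : (V.submatrix id σ)ᴴ * V.submatrix id σ = 1 := by
    rw [conjTranspose_submatrix, ← submatrix_mul _ _ _ _ _ Function.bijective_id, h1]
    simp
  refine ⟨V.submatrix id σ, h4, mul_eq_one_comm.1 h4, ?_⟩
  have : (V.submatrix id σ)ᴴ * A * V.submatrix id σ = (Vᴴ * A * V).submatrix σ σ := by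
    ext i j; simp [mul_apply]
  rw [this, h3]
  ext i j
  simp [diagonal_apply, σ, eigsDesc]

lemma interlace_core {m n : ℕ} (W : Matrix (Fin n) (Fin m) ℂ) (lam : Fin n → ℝ) (mu : Fin m → ℝ)
    (hl : Antitone lam) (hm : Antitone mu) (h1 : Wᴴ * W = 1)
    (h2 : Wᴴ * diagonal (fun i => (lam i : ℂ)) * W = diagonal (fun i => (mu i : ℂ)))
    (i : Fin m) (j : Fin n) (hij : (j : ℕ) ≤ i) : mu i ≤ lam j := by
  classical
  -- a nonzero vector supported on `≤ i`, whose image vanishes on `< j`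
  let f : ({l : Fin m // l ≤ i} → ℂ) →ₗ[ℂ] ({l : Fin n // l < j} → ℂ) :=
    (W.submatrix Subtype.val Subtype.val).mulVecLin
  have hlt : Module.finrank ℂ ({l : Fin n // l < j} → ℂ) <
      Module.finrank ℂ ({l : Fin m // l ≤ i} → ℂ) := by
    simp [Fintype.card_subtype]
    have e1 : (Finset.univ.filter fun l : Fin n => l < j) = Finset.Iio j := by ext; simp
    have e2 : (Finset.univ.filter fun l : Fin m => l ≤ i) = Finset.Iic i := by ext; simp
    rw [e1, e2, Fin.card_Iio, Fin.card_Iic]; omega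
  have hker := LinearMap.ker_ne_bot_of_finrank_lt (f := f) hlt
  obtain ⟨a, ha, ha0⟩ := Submodule.exists_mem_ne_zero_of_ne_bot hker
  let x : Fin m → ℂ := fun l => if h : l ≤ i then a ⟨l, h⟩ else 0
  have hx0 : ∀ l, ¬ l ≤ i → x l = 0 := fun l h => by simp [x, h]
  have hxa : ∀ l : {l : Fin m // l ≤ i}, x l = a l := fun l => by simp [x, l.2]
  set y := W *ᵥ x with hy
  have hy0 : ∀ l, l < j → y l = 0 := by
    intro l hl
    have h := congrFun (LinearMap.mem_ker.1 ha) ⟨l, hl⟩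
    simp only [f, mulVecLin_apply, mulVec, dotProduct, submatrix_apply, Pi.zero_apply] at h
    simp only [hy, mulVec, dotProduct]
    rw [← h]
    rw [← Fintype.sum_subtype_add_sum_subtype (· ≤ i)]
    rw [Finset.sum_eq_zero (s := (Finset.univ : Finset {l : Fin m // ¬ l ≤ i}))
      (fun l' _ => by rw [hx0 _ l'.2, mul_zero]), add_zero]
    exact Finset.sum_congr rfl fun l' _ => by rw [hxa]
  have n1 : ∑ l, ‖y l‖ ^ 2 = ∑ l, ‖x l‖ ^ 2 := by
    have : star y ⬝ᵥ y = star x ⬝ᵥ x := by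
      rw [hy, star_mulVec, ← dotProduct_mulVec, mulVec_mulVec, h1, one_mulVec]
    simp only [dotProduct, Pi.star_apply, RCLike.star_def, Complex.conj_mul'] at this
    exact_mod_cast this
  have n2 : ∑ l, lam l * ‖y l‖ ^ 2 = ∑ l, mu l * ‖x l‖ ^ 2 := by
    have : star y ⬝ᵥ (diagonal (fun i => (lam i : ℂ)) *ᵥ y)
        = star x ⬝ᵥ (diagonal (fun i => (mu i : ℂ)) *ᵥ x) := by
      rw [hy, star_mulVec, ← dotProduct_mulVec, mulVec_mulVec, mulVec_mulVec, h2]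
    simp only [dotProduct, Pi.star_apply, RCLike.star_def, mulVec_diagonal, mul_left_comm (starRingEnd ℂ _),
      Complex.conj_mul'] at this
    exact_mod_cast this
  have b1 : ∑ l, lam l * ‖y l‖ ^ 2 ≤ lam j * ∑ l, ‖y l‖ ^ 2 := by
    rw [Finset.mul_sum]
    refine Finset.sum_le_sum fun l _ => ?_
    by_cases h : l < j
    · simp [hy0 l h]
    · exact mul_le_mul_of_nonneg_right (hl (not_lt.1 h)) (by positivity)
  have b2 : mu i * ∑ l, ‖x l‖ ^ 2 ≤ ∑ l, mu l * ‖x l‖ ^ 2 := by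
    rw [Finset.mul_sum]
    refine Finset.sum_le_sum fun l _ => ?_
    by_cases h : l ≤ i
    · exact mul_le_mul_of_nonneg_right (hm h) (by positivity)
    · simp [hx0 l h]
  have hpos : 0 < ∑ l, ‖x l‖ ^ 2 := by
    obtain ⟨l, hl⟩ := Function.ne_iff.1 ha0
    refine Finset.sum_pos' (fun _ _ => by positivity) ⟨l, Finset.mem_univ _, ?_⟩
    rw [hxa]
    have : 0 < ‖a l‖ := norm_pos_iff.2 hl
    positivity
  rw [n1] at b1
  exact le_of_mul_le_mul_right (b2.trans (n2 ▸ b1)) hpos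

lemma interlace_core' {m n : ℕ} (W : Matrix (Fin n) (Fin m) ℂ) (lam : Fin n → ℝ) (mu : Fin m → ℝ)
    (hl : Antitone lam) (hm : Antitone mu) (h1 : Wᴴ * W = 1)
    (h2 : Wᴴ * diagonal (fun i => (lam i : ℂ)) * W = diagonal (fun i => (mu i : ℂ)))
    (i : Fin m) (j : Fin n) (hij : (i : ℕ) + n ≤ j + m) : lam j ≤ mu i := by
  have := interlace_core (W.submatrix Fin.revPerm Fin.revPerm) (fun i => - lam i.rev)
    (fun i => - mu i.rev) (fun a b h => neg_le_neg (hl (Fin.rev_le_rev.2 h)))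
    (fun a b h => neg_le_neg (hm (Fin.rev_le_rev.2 h)))
    (by rw [conjTranspose_submatrix, submatrix_mul_equiv, h1, submatrix_one_equiv])
    (by
      have e1 : diagonal (fun i : Fin n => ((- lam i.rev : ℝ) : ℂ))
          = - (diagonal (fun i => (lam i : ℂ))).submatrix Fin.revPerm Fin.revPerm := by
        rw [submatrix_diagonal_equiv]
        ext i j; by_cases h : i = j <;> simp [diagonal_apply, h]
      have e2 : diagonal (fun i : Fin m => ((- mu i.rev : ℝ) : ℂ))
          = - (diagonal (fun i => (mu i : ℂ))).submatrix Fin.revPerm Fin.revPerm := by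
        rw [submatrix_diagonal_equiv]
        ext i j; by_cases h : i = j <;> simp [diagonal_apply, h]
      rw [e1, e2, conjTranspose_submatrix, Matrix.mul_neg, Matrix.neg_mul, submatrix_mul_equiv,
        submatrix_mul_equiv, h2])
    i.rev j.rev (by simp only [Fin.val_rev]; omega)
  simpa using this

lemma cauchy_interlace {n : ℕ} {H : Matrix (Fin (n+1)) (Fin (n+1)) ℂ} (hH : H.IsHermitian)
    {M : Matrix (Fin n) (Fin n) ℂ} (hM : M.IsHermitian)
    (h : M = H.submatrix Fin.castSucc Fin.castSucc) (i : Fin n) :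
    eigsDesc hM i ≤ eigsDesc hH i.castSucc ∧ eigsDesc hH i.succ ≤ eigsDesc hM i := by
  obtain ⟨U, hU1, hU2, hU⟩ := eigsDesc_diag hH
  obtain ⟨V, hV1, hV2, hV⟩ := eigsDesc_diag hM
  set J : Matrix (Fin (n+1)) (Fin n) ℂ := (1 : Matrix _ _ ℂ).submatrix id Fin.castSucc with hJ
  have hJJ : Jᴴ * J = 1 := by
    ext a b; simp [hJ, mul_apply, one_apply]
  have hJH : Jᴴ * H * J = M := by
    rw [h]; ext a b; simp [hJ, mul_apply, one_apply]
  have hUH : U * diagonal (fun i => ((eigsDesc hH i : ℝ) : ℂ)) * Uᴴ = H := by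
    rw [← hU]
    calc U * (Uᴴ * H * U) * Uᴴ = (U * Uᴴ) * H * (U * Uᴴ) := by simp only [mul_assoc]
      _ = H := by rw [hU2, one_mul, mul_one]
  have h1 : (Uᴴ * J * V)ᴴ * (Uᴴ * J * V) = 1 := by
    calc _ = Vᴴ * (Jᴴ * (U * Uᴴ) * J) * V := by
          simp only [conjTranspose_mul, conjTranspose_conjTranspose, Matrix.mul_assoc]
      _ = 1 := by rw [hU2, Matrix.mul_one, hJJ, Matrix.mul_one, hV1]
  have h2 : (Uᴴ * J * V)ᴴ * diagonal (fun i => ((eigsDesc hH i : ℝ) : ℂ)) * (Uᴴ * J * V)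
      = diagonal (fun i => ((eigsDesc hM i : ℝ) : ℂ)) := by
    calc _ = Vᴴ * (Jᴴ * (U * diagonal (fun i => ((eigsDesc hH i : ℝ) : ℂ)) * Uᴴ) * J) * V := by
          simp only [conjTranspose_mul, conjTranspose_conjTranspose, Matrix.mul_assoc]
      _ = _ := by rw [hUH, hJH, hV]
  exact ⟨interlace_core _ _ _ (eigsDesc_antitone hH) (eigsDesc_antitone hM) h1 h2 _ _ (by simp),
    interlace_core' _ _ _ (eigsDesc_antitone hH) (eigsDesc_antitone hM) h1 h2 _ _ (by simp; omega)⟩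

lemma eigsDesc_conj {n : ℕ} (A : Matrix (Fin n) (Fin n) ℂ) :
    eigsDesc (isHermitian_mul_conjTranspose_self A) =
      eigsDesc (isHermitian_conjTranspose_mul_self A) :=
  eigsDesc_congr _ _ (charpoly_mul_comm _ _)

lemma upper_interlace {n : ℕ} {A : Matrix (Fin (n+1)) (Fin (n+1)) ℂ} (hA : A ∈ UpperTriPos (n+1))
    {B : Matrix (Fin n) (Fin n) ℂ} (hB : B = A.submatrix Fin.castSucc Fin.castSucc) (i : Fin n) :
    eigsDesc (isHermitian_mul_conjTranspose_self B) i ≤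
        eigsDesc (isHermitian_mul_conjTranspose_self A) i.castSucc ∧
      eigsDesc (isHermitian_mul_conjTranspose_self A) i.succ ≤
        eigsDesc (isHermitian_mul_conjTranspose_self B) i := by
  rw [eigsDesc_conj, eigsDesc_conj]
  apply cauchy_interlace
  ext a b
  simp [hB, mul_apply, Fin.sum_univ_castSucc, hA.1 (Fin.last n) b.castSucc (Fin.castSucc_lt_last b)]

open scoped ComplexOrder in
lemma upper_pos {n : ℕ} {A : Matrix (Fin n) (Fin n) ℂ} (hA : A ∈ UpperTriPos n) (i : Fin n) :
    0 < eigsDesc (isHermitian_mul_conjTranspose_self A) i := by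
  have hdet : A.det ≠ 0 := by
    rw [det_of_isUpperTriangular (fun i j h => hA.1 i j h), Finset.prod_ne_zero_iff]
    intro i _ h
    have := (hA.2 i).1
    simp [h] at this
  have hu : IsUnit A := (isUnit_iff_isUnit_det A).2 (isUnit_iff_ne_zero.2 hdet)
  have : (A * Aᴴ).PosDef := by
    refine PosDef.mul_conjTranspose_self A ?_
    exact vecMul_injective_iff_isUnit.2 hu
  exact this.eigenvalues_pos _

lemma upper_sub {n k : ℕ} {A : Matrix (Fin n) (Fin n) ℂ} (hA : A ∈ UpperTriPos n) (h : k ≤ n) :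
    A.submatrix (Fin.castLE h) (Fin.castLE h) ∈ UpperTriPos k :=
  ⟨fun i j hij => hA.1 _ _ (by simpa using hij), fun i => hA.2 _⟩

/-- tableau difference -/
lemma LBtab_diff {n : ℕ} (A : Matrix (Fin n) (Fin n) ℂ) (k i : ℕ) (hi : i < k) (hk : k ≤ n) :
    LBtab A k (i + 1) - LBtab A k i = (1 / 2) * Real.log (eigsDesc
      (isHermitian_mul_conjTranspose_self (A.submatrix (Fin.castLE hk) (Fin.castLE hk))) ⟨i, hi⟩) := by
  rcases i with _ | i
  · rw [LBtab, dif_pos ⟨by omega, by omega, hk⟩, LBtab, dif_neg (by omega)]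
    simp only [lB, sub_zero]
    congr 1
    have : Finset.Iic (⟨0 + 1 - 1, by omega⟩ : Fin k) = {⟨0, hi⟩} := by
      ext a; simp [Fin.le_def, Fin.ext_iff]
    rw [this, Finset.sum_singleton]
  · rw [LBtab, dif_pos ⟨by omega, by omega, hk⟩, LBtab, dif_pos ⟨by omega, by omega, hk⟩]
    simp only [lB]
    rw [← mul_sub]
    congr 1
    have : Finset.Iic (⟨i + 1 + 1 - 1, by omega⟩ : Fin k)
        = insert ⟨i + 1, hi⟩ (Finset.Iic ⟨i + 1 - 1, by omega⟩) := by
      ext a; simp [Fin.le_def, Fin.ext_iff]; omega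
    rw [this, Finset.sum_insert (by simp [Fin.le_def])]
    ring

lemma LBtab_zero {n : ℕ} (A : Matrix (Fin n) (Fin n) ℂ) (k : ℕ) : LBtab A k 0 = 0 := by
  rw [LBtab, dif_neg (by omega)]

lemma forward {n : ℕ} (A : Matrix (Fin n) (Fin n) ℂ) (hA : A ∈ UpperTriPos n) :
    IsGZTableau n (LBtab A) := by
  refine ⟨fun k _ => LBtab_zero A k, fun k i h1 hik hk => ?_⟩
  obtain ⟨i, rfl⟩ : ∃ j, i = j + 1 := ⟨i - 1, by omega⟩
  have d1 := LBtab_diff A (k+1) i (by omega) hk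
  have d2 := LBtab_diff A (k+1) (i+1) (by omega) hk
  have d3 := LBtab_diff A k i (by omega) hk.le
  have hA1 := upper_sub hA (show k + 1 ≤ n from hk)
  have hA0 := upper_sub hA hk.le
  obtain ⟨e1, e2⟩ := upper_interlace hA1
    (B := A.submatrix (Fin.castLE hk.le) (Fin.castLE hk.le)) (by ext; rfl) ⟨i, by omega⟩
  have l1 := Real.log_le_log (upper_pos hA0 _) e1
  have l2 := Real.log_le_log (upper_pos hA1 _) e2
  simp only [Fin.castSucc_mk, Fin.succ_mk] at l1 l2
  simp only [Nat.add_sub_cancel]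
  constructor <;> linarith

lemma prod_erase_succAbove {k : ℕ} (f : Fin (k+1) → ℝ) (i : Fin (k+1)) :
    ∏ j ∈ Finset.univ.erase i, f j = ∏ j, f (i.succAbove j) := by
  rw [Fin.univ_succAbove k i, Finset.erase_cons, Finset.prod_map]
  rfl

open Polynomial in
/-- strict case of the partial fraction lemma -/
lemma pf_strict {k : ℕ} (lam : Fin (k+1) → ℝ) (mu : Fin k → ℝ)
    (h1 : ∀ i, mu i < lam i.castSucc) (h2 : ∀ i, lam i.succ < mu i) :
    ∃ (c : ℝ) (w : Fin k → ℝ), (∀ i, 0 ≤ w i) ∧ ∀ x : ℝ,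
      ∏ j, (x - lam j) = (x - c) * ∏ i, (x - mu i)
        - ∑ i, w i * ∏ j ∈ Finset.univ.erase i, (x - mu j) := by
  classical
  have hlam : StrictAnti lam := Fin.strictAnti_iff_succ_lt.2 fun i => (h2 i).trans (h1 i)
  have hle : ∀ {i j : Fin k}, i < j → mu j < lam i.succ := fun {i j} h =>
    (h1 j).trans_le (hlam.antitone (by rw [Fin.le_def]; simpa using h))
  have hmu : StrictAnti mu := fun i j h => (hle h).trans (h2 i)
  have hinj : Set.InjOn mu (Finset.univ : Finset (Fin k)) := hmu.injective.injOn
  set p : ℝ[X] := Lagrange.nodal Finset.univ lam with hp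
  set q : ℝ[X] := Lagrange.nodal Finset.univ mu with hq
  have hqm : q.Monic := Lagrange.nodal_monic
  have hpm : p.Monic := Lagrange.nodal_monic
  have hqd : q.natDegree = k := by rw [hq, Lagrange.natDegree_nodal]; simp
  have hpd : p.natDegree = k + 1 := by rw [hp, Lagrange.natDegree_nodal]; simp
  -- division
  have hmm : (p /ₘ q).Monic := by
    rw [Monic, leadingCoeff_divByMonic_of_monic hqm]
    · exact hpm
    · rw [degree_eq_natDegree hqm.ne_zero, degree_eq_natDegree hpm.ne_zero, hqd, hpd]
      exact_mod_cast Nat.le_succ k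
  have hmd : (p /ₘ q).natDegree = 1 := by
    rw [natDegree_divByMonic _ hqm, hqd, hpd]; omega
  obtain ⟨c, hc⟩ : ∃ c, p /ₘ q = X - C c := by
    refine ⟨- (p /ₘ q).coeff 0, ?_⟩
    rw [hmm.eq_X_add_C hmd] ; simp
  set r := p %ₘ q with hr
  have hrd : r.degree < (Finset.univ : Finset (Fin k)).card := by
    have := degree_modByMonic_lt p hqm
    rw [degree_eq_natDegree hqm.ne_zero, hqd] at this
    simpa using this
  have hpq : p = r + q * (X - C c) := by rw [← hc, hr, modByMonic_add_div]
  have hev : ∀ i, r.eval (mu i) = p.eval (mu i) := by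
    intro i
    rw [hpq, eval_add, eval_mul, hq, Lagrange.eval_nodal_at_node (Finset.mem_univ i)]; simp
  let D : Fin k → ℝ := fun i => ∏ j ∈ Finset.univ.erase i, (mu i - mu j)
  have hD : ∀ i, D i ≠ 0 := fun i => Finset.prod_ne_zero_iff.2 fun j hj =>
    sub_ne_zero.2 fun h => (Finset.ne_of_mem_erase hj) (hmu.injective h.symm)
  refine ⟨c, fun i => - p.eval (mu i) / D i, ?_, ?_⟩
  · intro i
    -- signs
    obtain ⟨k, rfl⟩ : ∃ m, k = m + 1 := ⟨k - 1, by have := i.2; omega⟩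
    have e1 : p.eval (mu i) = (mu i - lam i.castSucc) * ((mu i - lam i.succ) *
        ∏ j : Fin k, (mu i - lam (i.castSucc.succAbove (i.succAbove j)))) := by
      rw [hp, Lagrange.eval_nodal, Fin.prod_univ_succAbove _ i.castSucc,
        Fin.prod_univ_succAbove _ i]
      simp
    have e2 : D i = ∏ j : Fin k, (mu i - mu (i.succAbove j)) :=
      prod_erase_succAbove (fun j => mu i - mu j) i
    have e3 : - p.eval (mu i) / D i = (lam i.castSucc - mu i) * (mu i - lam i.succ) *
        ∏ j : Fin k, ((mu i - lam (i.castSucc.succAbove (i.succAbove j))) /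
          (mu i - mu (i.succAbove j))) := by
      rw [e1, e2, Finset.prod_div_distrib]; ring
    show 0 ≤ - p.eval (mu i) / D i
    rw [e3]
    refine mul_nonneg (mul_nonneg (sub_nonneg.2 (h1 i).le) (sub_nonneg.2 (h2 i).le)) ?_
    refine Finset.prod_nonneg fun j _ => ?_
    rcases lt_or_ge j.castSucc i with hj | hj
    · have s1 : i.succAbove j = j.castSucc := Fin.succAbove_of_castSucc_lt _ _ hj
      have s2 : i.castSucc.succAbove j.castSucc = j.castSucc.castSucc :=
        Fin.succAbove_of_castSucc_lt _ _ (by simpa using hj)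
      rw [s1, s2]
      have := hmu hj
      have := h1 j.castSucc
      exact div_nonneg_of_nonpos (by linarith) (by linarith)
    · have s1 : i.succAbove j = j.succ := Fin.succAbove_of_le_castSucc _ _ hj
      have s2 : i.castSucc.succAbove j.succ = j.succ.succ := by
        apply Fin.succAbove_of_le_castSucc
        rw [Fin.le_def] at *; simp at *; omega
      rw [s1, s2]
      have : mu j.succ < mu i := hmu (by rw [Fin.lt_def]; rw [Fin.le_def] at hj; simp at *; omega)
      have := h2 j.succ
      exact div_nonneg (by linarith) (by linarith)
  · intro x
    have hb := Lagrange.eq_interpolate hinj hrd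
    have hb2 : r.eval x = ∑ i, p.eval (mu i) / D i * ∏ j ∈ Finset.univ.erase i, (x - mu j) := by
      rw [hb, Lagrange.interpolate_apply, eval_finsetSum]
      refine Finset.sum_congr rfl fun i _ => ?_
      rw [eval_mul, eval_C, hev, Lagrange.basis, eval_prod]
      simp only [Lagrange.basisDivisor, eval_mul, eval_C, eval_sub, eval_X]
      rw [Finset.prod_mul_distrib, Finset.prod_inv_distrib, div_eq_mul_inv, mul_assoc]
    have := congrArg (eval x) hpq
    rw [eval_add, eval_mul, hb2, hp, hq, Lagrange.eval_nodal, Lagrange.eval_nodal] at this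
    rw [this]
    simp only [neg_div, neg_mul, Finset.sum_neg_distrib, eval_sub, eval_X, eval_C, hp, Lagrange.eval_nodal]
    ring

/-- partial fraction lemma -/
lemma pf {k : ℕ} : ∀ (lam : Fin (k+1) → ℝ) (mu : Fin k → ℝ)
    (_ : ∀ i, mu i ≤ lam i.castSucc) (_ : ∀ i, lam i.succ ≤ mu i),
    ∃ (c : ℝ) (w : Fin k → ℝ), (∀ i, 0 ≤ w i) ∧ ∀ x : ℝ,
      ∏ j, (x - lam j) = (x - c) * ∏ i, (x - mu i)
        - ∑ i, w i * ∏ j ∈ Finset.univ.erase i, (x - mu j) := by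
  induction k with
  | zero => intro lam mu h1 h2; exact pf_strict lam mu (fun i => i.elim0) (fun i => i.elim0)
  | succ k ih =>
    intro lam mu h1 h2
    by_cases hs : (∀ i, mu i < lam i.castSucc) ∧ ∀ i, lam i.succ < mu i
    · exact pf_strict lam mu hs.1 hs.2
    have key : ∀ (i : Fin (k+1)) (l : Fin (k+2)), lam l = mu i →
        (∀ m, mu (i.succAbove m) ≤ lam (l.succAbove m.castSucc)) →
        (∀ m, lam (l.succAbove m.succ) ≤ mu (i.succAbove m)) →
        ∃ (c : ℝ) (w : Fin (k+1) → ℝ), (∀ i, 0 ≤ w i) ∧ ∀ x : ℝ,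
          ∏ j, (x - lam j) = (x - c) * ∏ i, (x - mu i)
            - ∑ i, w i * ∏ j ∈ Finset.univ.erase i, (x - mu j) := by
      intro i l hl g1 g2
      obtain ⟨c, w, hw, h⟩ := ih (fun m => lam (l.succAbove m)) (fun m => mu (i.succAbove m)) g1 g2
      refine ⟨c, i.insertNth 0 w, ?_, fun x => ?_⟩
      · intro j
        refine Fin.succAboveCases i ?_ (fun m => ?_) j
        · simp
        · simpa using hw m
      · rw [Fin.prod_univ_succAbove _ l, h x, Fin.prod_univ_succAbove _ i, hl,
          Fin.sum_univ_succAbove _ i]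
        simp only [Fin.insertNth_apply_same, Fin.insertNth_apply_succAbove, zero_mul, zero_add]
        rw [mul_sub, Finset.mul_sum]
        congr 1
        · ring
        · refine Finset.sum_congr rfl fun m _ => ?_
          have : (Finset.univ.erase (i.succAbove m)) =
              insert i ((Finset.univ.erase m).map i.succAboveEmb) := by
            ext j
            refine Fin.succAboveCases i ?_ (fun m' => ?_) j
            · simp [Fin.succAbove_ne, (Fin.succAbove_ne i m).symm]
            · simp [Fin.succAbove_ne]
          rw [this, Finset.prod_insert (by simp [Fin.succAbove_ne]), Finset.prod_map]
          simp only [Fin.succAboveEmb_apply]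
          ring
    have hlam : Antitone lam := Fin.antitone_iff_succ_le.2 fun i => (h2 i).trans (h1 i)
    have hmu : Antitone mu := Fin.antitone_iff_succ_le.2 fun i => by
      have a := h1 i.succ
      have b := h2 i.castSucc
      rw [Fin.succ_castSucc] at b
      exact a.trans b
    have : ∃ i, mu i = lam i.castSucc ∨ mu i = lam i.succ := by
      by_contra hcon
      push Not at hcon
      exact hs ⟨fun i => lt_of_le_of_ne (h1 i) (hcon i).1, fun i =>
        lt_of_le_of_ne (h2 i) (hcon i).2.symm⟩
    obtain ⟨i, hi | hi⟩ := this
    · refine key i i.castSucc hi.symm (fun m => ?_) (fun m => ?_)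
      · refine (h1 _).trans (hlam ?_)
        simp only [Fin.succAbove, Fin.lt_def, Fin.le_def]
        split_ifs <;> simp_all <;> omega
      · refine le_trans (hlam ?_) (h2 _)
        simp only [Fin.succAbove, Fin.lt_def, Fin.le_def]
        split_ifs <;> simp_all <;> omega
    · refine key i i.succ hi.symm (fun m => ?_) (fun m => ?_)
      · refine (h1 _).trans (hlam ?_)
        simp only [Fin.succAbove, Fin.lt_def, Fin.le_def]
        split_ifs <;> simp_all <;> omega
      · refine le_trans (hlam ?_) (h2 _)
        simp only [Fin.succAbove, Fin.lt_def, Fin.le_def]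
        split_ifs <;> simp_all <;> omega

open Polynomial in
lemma bordered_charpoly {k : ℕ} (lam : Fin (k+1) → ℝ) (mu b : Fin k → ℝ) (c : ℝ)
    (h : ∀ x : ℝ, ∏ j, (x - lam j) = (x - c) * ∏ i, (x - mu i)
        - ∑ i, b i ^ 2 * ∏ j ∈ Finset.univ.erase i, (x - mu j)) :
    (fromBlocks (diagonal fun i => (mu i : ℂ)) (of fun i (_ : Fin 1) => (b i : ℂ))
      (of fun (_ : Fin 1) i => (b i : ℂ)) (of fun (_ _ : Fin 1) => (c : ℂ))).charpoly
      = ∏ j, (X - C (lam j : ℂ)) := by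
  apply Polynomial.eq_of_infinite_eval_eq
  have hinf : ((fun x : ℝ => (x : ℂ)) '' (Set.range mu)ᶜ).Infinite :=
    (Set.finite_range mu).infinite_compl.image (Complex.ofReal_injective.injOn)
  refine hinf.mono ?_
  rintro _ ⟨x, hx, rfl⟩
  have hx' : ∀ i, x - mu i ≠ 0 := fun i hi => hx ⟨i, by linarith⟩
  have hxC : ∀ i, (x : ℂ) - mu i ≠ 0 := fun i => by exact_mod_cast hx' i
  simp only [Set.mem_ofPred_eq]
  rw [eval_charpoly, eval_prod]
  have e : scalar (Fin k ⊕ Fin 1) (x : ℂ) - fromBlocks (diagonal fun i => (mu i : ℂ))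
      (of fun i (_ : Fin 1) => (b i : ℂ))
      (of fun (_ : Fin 1) i => (b i : ℂ)) (of fun (_ _ : Fin 1) => (c : ℂ))
      = fromBlocks (diagonal fun i => ((x - mu i : ℂ))) (of fun i (_ : Fin 1) => -(b i : ℂ))
      (of fun (_ : Fin 1) i => -(b i : ℂ)) (of fun (_ _ : Fin 1) => (x - c : ℂ)) := by
    ext i j
    rcases i with i | i <;> rcases j with j | j
    · by_cases hij : i = j <;> simp [diagonal_apply, hij]
    · simp
    · simp
    · have : i = j := Subsingleton.elim _ _
      simp [this]
  rw [e]
  letI : Invertible (diagonal fun i => ((x - mu i : ℂ))) :=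
    ⟨diagonal fun i => ((x - mu i : ℂ))⁻¹, by simp [hxC], by simp [hxC]⟩
  have hinv : ⅟(diagonal fun i => ((x - mu i : ℂ))) = diagonal fun i => ((x - mu i : ℂ))⁻¹ := rfl
  rw [det_fromBlocks₁₁, hinv, det_diagonal, det_fin_one]
  simp only [eval_sub, eval_X, eval_C, Matrix.sub_apply, of_apply, mul_apply, diagonal_apply, mul_ite,
    mul_zero, Finset.sum_ite_eq, Finset.sum_ite_eq', Finset.mem_univ, if_true]
  have h3 : ∏ j, ((x : ℂ) - lam j) = (x - c) * ∏ i, ((x : ℂ) - mu i)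
        - ∑ i, (b i : ℂ) ^ 2 * ∏ j ∈ Finset.univ.erase i, ((x : ℂ) - mu j) := by exact_mod_cast h x
  rw [h3, mul_sub, mul_comm, Finset.mul_sum]
  congr 1
  refine Finset.sum_congr rfl fun i _ => ?_
  rw [← Finset.mul_prod_erase Finset.univ _ (Finset.mem_univ i)]
  field_simp [hxC i]

open Polynomial in
lemma extend_step {k : ℕ} {A : Matrix (Fin k) (Fin k) ℂ} (hA : A ∈ UpperTriPos k)
    (lam : Fin (k+1) → ℝ) (hpos : ∀ i, 0 < lam i) (hanti : Antitone lam)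
    (h1 : ∀ i, eigsDesc (isHermitian_mul_conjTranspose_self A) i ≤ lam i.castSucc)
    (h2 : ∀ i, lam i.succ ≤ eigsDesc (isHermitian_mul_conjTranspose_self A) i) :
    ∃ A' ∈ UpperTriPos (k+1), A'.submatrix Fin.castSucc Fin.castSucc = A ∧
      eigsDesc (isHermitian_mul_conjTranspose_self A') = lam := by
  have hmupos := upper_pos hA
  obtain ⟨c, w, hw, hpf⟩ := pf lam _ h1 h2
  rw [eigsDesc_conj] at hmupos hpf
  obtain ⟨U, hU1, hU2, hU⟩ := eigsDesc_diag (isHermitian_conjTranspose_mul_self A)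
  set mu := eigsDesc (isHermitian_conjTranspose_mul_self A) with hmu
  let b : Fin k → ℝ := fun i => √(w i)
  have hb : ∀ i, b i ^ 2 = w i := fun i => Real.sq_sqrt (hw i)
  -- the squared corner entry
  have he : 0 < c - ∑ i, b i ^ 2 / mu i := by
    have h0 := hpf 0
    simp only [zero_sub, Finset.prod_neg, Finset.card_univ, Fintype.card_fin] at h0
    have hP : 0 < ∏ i, mu i := Finset.prod_pos fun i _ => hmupos i
    have hL : 0 < ∏ i, lam i := Finset.prod_pos fun i _ => hpos i
    have hS : ∑ i, w i * ((-1) ^ (Finset.univ.erase i).card * ∏ j ∈ Finset.univ.erase i, mu j)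
        = - ((-1) ^ k * ((∏ i, mu i) * ∑ i, b i ^ 2 / mu i)) := by
      rw [Finset.mul_sum, Finset.mul_sum, ← Finset.sum_neg_distrib]
      refine Finset.sum_congr rfl fun i _ => ?_
      obtain ⟨m, rfl⟩ : ∃ m, k = m + 1 := ⟨k - 1, by have := i.2; omega⟩
      have := (hmupos i).ne'
      rw [hb, ← Finset.mul_prod_erase Finset.univ mu (Finset.mem_univ i),
        Finset.card_erase_of_mem (Finset.mem_univ i)]
      simp only [Finset.card_univ, Fintype.card_fin, Nat.add_sub_cancel, pow_succ]
      field_simp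
    rw [hS] at h0
    have h3 : (-1 : ℝ) ^ k * ∏ i, lam i
        = (-1) ^ k * ((∏ i, mu i) * (c - ∑ i, b i ^ 2 / mu i)) := by
      rw [pow_succ] at h0; linear_combination - h0
    have h4 := mul_left_cancel₀ (pow_ne_zero k (by norm_num : (-1 : ℝ) ≠ 0)) h3
    rw [h4] at hL
    exact (pos_iff_pos_of_mul_pos hL).1 hP
  set d : ℝ := √(c - ∑ i, b i ^ 2 / mu i) with hd
  have hdpos : 0 < d := Real.sqrt_pos.2 he
  have hdsq : d * d = c - ∑ i, b i ^ 2 / mu i := Real.mul_self_sqrt he.le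
  let bc : Matrix (Fin k) (Fin 1) ℂ := of fun i _ => (b i : ℂ)
  let bd : Matrix (Fin k) (Fin 1) ℂ := of fun i _ => ((b i / mu i : ℝ) : ℂ)
  let D : Matrix (Fin k) (Fin k) ℂ := diagonal fun i => (mu i : ℂ)
  have hDbd : D * bd = bc := by
    ext i j
    have := (hmupos i).ne'
    simp only [D, bd, bc, diagonal_mul, of_apply]
    rw [← Complex.ofReal_mul]
    congr 1; field_simp
  let v : Matrix (Fin k) (Fin 1) ℂ := A * U * bd
  let dm : Matrix (Fin 1) (Fin 1) ℂ := of fun _ _ => (d : ℂ)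
  let T : Matrix (Fin k ⊕ Fin 1) (Fin k ⊕ Fin 1) ℂ := fromBlocks A v 0 dm
  let P : Matrix (Fin k ⊕ Fin 1) (Fin k ⊕ Fin 1) ℂ := fromBlocks U 0 0 1
  have hPP : P * Pᴴ = 1 := by
    simp [P, fromBlocks_conjTranspose, fromBlocks_multiply, hU2]
  have hU' : Uᴴ * (Aᴴ * (A * U)) = D := by simp only [D, ← hU, Matrix.mul_assoc]
  have hvv : vᴴ * v + dmᴴ * dm = of fun (_ _ : Fin 1) => (c : ℂ) := by
    have : vᴴ * v = bdᴴ * bc := by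
      rw [← hDbd, ← hU']
      simp only [v, conjTranspose_mul, Matrix.mul_assoc]
    rw [this]
    ext i j
    simp only [Matrix.add_apply, mul_apply, conjTranspose_apply, bd, bc, dm, of_apply, RCLike.star_def,
      Complex.conj_ofReal, Finset.univ_unique, Finset.sum_singleton]
    rw [← Complex.ofReal_mul, hdsq]
    push_cast
    rw [add_sub_left_comm]
    rw [← Finset.sum_sub_distrib, Finset.sum_eq_zero, add_zero]
    intro i _; ring
  have hPTTP : Pᴴ * (Tᴴ * T) * P = fromBlocks D bc bcᴴ (of fun (_ _ : Fin 1) => (c : ℂ)) := by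
    have hAv : Uᴴ * (Aᴴ * v) = bc := by
      rw [← hDbd, ← hU']; simp only [v, Matrix.mul_assoc]
    have hvA : vᴴ * (A * U) = bcᴴ := by
      rw [← hAv]; simp only [conjTranspose_mul, conjTranspose_conjTranspose, Matrix.mul_assoc]
    rw [← hvv, ← hvA, ← hAv, ← hU']
    simp [P, T, fromBlocks_conjTranspose, fromBlocks_multiply, Matrix.mul_assoc]
  have hbcH : bcᴴ = of fun (_ : Fin 1) i => (b i : ℂ) := by
    ext i j; simp [bc]
  have hchar : (Tᴴ * T).charpoly = ∏ j, (X - C (lam j : ℂ)) := by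
    rw [← bordered_charpoly lam mu b c (by simpa only [hb] using hpf), ← hbcH, ← hPTTP,
      charpoly_mul_comm _ P, ← Matrix.mul_assoc P, hPP, Matrix.one_mul]
  let e : Fin k ⊕ Fin 1 ≃ Fin (k+1) := finSumFinEquiv
  have es1 : ∀ i : Fin k, e.symm i.castSucc = Sum.inl i := fun i => by
    rw [Equiv.symm_apply_eq]; rfl
  have es2 : e.symm (Fin.last k) = Sum.inr 0 := by
    rw [Equiv.symm_apply_eq]; rfl
  refine ⟨T.submatrix e.symm e.symm, ⟨?_, ?_⟩, ?_, ?_⟩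
  · intro i j hij
    induction i using Fin.lastCases with
    | last =>
      induction j using Fin.lastCases with
      | last => exact absurd hij (lt_irrefl _)
      | cast j => simp [es1, es2, T]
    | cast i =>
      induction j using Fin.lastCases with
      | last => exact absurd hij (not_lt.2 (Fin.le_last _))
      | cast j =>
        simp only [submatrix_apply, es1, T, fromBlocks_apply₁₁]
        exact hA.1 i j (by simpa using hij)
  · intro i
    induction i using Fin.lastCases with
    | last => simpa [es2, T, dm] using hdpos
    | cast i => simpa [es1, T] using hA.2 i
  · ext i j; simp [es1, T]
  · rw [eigsDesc_conj]
    refine eigsDesc_eq _ hanti ?_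
    rw [conjTranspose_submatrix, submatrix_mul_equiv, ← hchar]
    exact charpoly_reindex e (Tᴴ * T)

lemma backward (n : ℕ) : ∀ Ξ : ℕ → ℕ → ℝ, IsGZTableau n Ξ →
      ∃ A ∈ UpperTriPos n, ∀ k i : ℕ, i ≤ k → k ≤ n → LBtab A k i = Ξ k i := by
  induction n with
  | zero =>
    intro Ξ h
    refine ⟨0, ⟨fun i => i.elim0, fun i => i.elim0⟩, fun k i hik hk => ?_⟩
    obtain rfl : k = 0 := by omega
    obtain rfl : i = 0 := by omega
    rw [LBtab_zero, h.1 0 le_rfl]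
  | succ n ih =>
    intro Ξ h
    obtain ⟨A, hA, hAΞ⟩ := ih Ξ ⟨fun k hk => h.1 k (by omega),
      fun k i a b c => h.2 k i a b (by omega)⟩
    have heig : ∀ i : Fin n, eigsDesc (isHermitian_mul_conjTranspose_self A) i
        = Real.exp (2 * (Ξ n (i + 1) - Ξ n i)) := by
      intro i
      have d := LBtab_diff A n i i.2 le_rfl
      rw [hAΞ _ _ (by omega) le_rfl, hAΞ _ _ (by omega) le_rfl] at d
      have e : A.submatrix (Fin.castLE le_rfl) (Fin.castLE le_rfl) = A := by ext; rfl
      simp only [e] at d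
      rw [d, ← mul_assoc]; norm_num
      rw [Real.exp_log (upper_pos hA _)]
    let lam : Fin (n+1) → ℝ := fun i => Real.exp (2 * (Ξ (n+1) (i + 1) - Ξ (n+1) i))
    have h1 : ∀ i : Fin n, eigsDesc (isHermitian_mul_conjTranspose_self A) i ≤ lam i.castSucc := by
      intro i
      rw [heig]
      refine Real.exp_le_exp.2 ?_
      have := (h.2 n (i+1) (by omega) (by omega) (by omega)).1
      simp only [Nat.add_sub_cancel, Fin.val_castSucc] at *
      linarith
    have h2 : ∀ i : Fin n, lam i.succ ≤ eigsDesc (isHermitian_mul_conjTranspose_self A) i := by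
      intro i
      rw [heig]
      refine Real.exp_le_exp.2 ?_
      have := (h.2 n (i+1) (by omega) (by omega) (by omega)).2
      simp only [Nat.add_sub_cancel, Fin.val_succ] at *
      linarith
    obtain ⟨A', hA', hsub, heig'⟩ := extend_step hA lam (fun i => Real.exp_pos _)
      (Fin.antitone_iff_succ_le.2 fun i => (h2 i).trans (h1 i)) h1 h2
    refine ⟨A', hA', fun k i hik hk => ?_⟩
    rcases Nat.lt_or_ge n k with hlt | hle
    · obtain rfl : k = n + 1 := by omega
      induction i with
      | zero => rw [LBtab_zero, h.1 _ le_rfl]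
      | succ i ihi =>
        have d := LBtab_diff A' (n+1) i (by omega) le_rfl
        have e : A'.submatrix (Fin.castLE le_rfl) (Fin.castLE le_rfl) = A' := by ext; rfl
        simp only [e] at d
        rw [ihi (by omega), heig', Real.log_exp] at d
        simp only at d
        linarith
    · rw [← hAΞ k i hik hle]
      unfold LBtab
      by_cases hc : 1 ≤ i
      · rw [dif_pos ⟨hc, hik, hk⟩, dif_pos ⟨hc, hik, hle⟩, ← hsub]
        rfl
      · rw [dif_neg (by omega), dif_neg (by omega)]


/-- The image of the Gelfand–Zeitlin map `L_B : B → ℝ^∇` is exactly the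
Gelfand–Zeitlin cone `Δ_GZ`. -/
theorem image_LB_eq_GZ_cone (n : ℕ) (hn : 0 < n) :
    (∀ A ∈ UpperTriPos n, IsGZTableau n (LBtab A)) ∧
    (∀ Ξ : ℕ → ℕ → ℝ, IsGZTableau n Ξ →
      ∃ A ∈ UpperTriPos n, ∀ k i : ℕ, i ≤ k → k ≤ n → LBtab A k i = Ξ k i) :=
  ⟨fun A hA => forward A hA, backward n⟩
end

section
/- Fix a positive integer n. Let Ξ be an interior point of the Gelfand–Zeitlin cone Δ_GZ, i.e., a tableau with l^k_0 = 0 for all k and with all the interlacing inequalities strict: l^{k+1}_i + l^k_{i−1} > l^{k+1}_{i−1} + l^k_i and l^{k+1}_i + l^k_i > l^{k+1}_{i+1} + l^k_{i−1} for all 1 ≤ i ≤ k < n. Then the fiber L_B^{-1}(Ξ), with the subspace topology from the n×n complex matrices, is homeomorphic to the torus (S¹)^{n(n−1)/2}. -/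
open Matrix

/-- The fiber of the Gelfand–Zeitlin map `L_B : B → ℝ^∇` over the tableau `Ξ`. -/
def LBfiber (n : ℕ) (Ξ : ℕ → ℕ → ℝ) : Set (Matrix (Fin n) (Fin n) ℂ) :=
  {A | A ∈ UpperTriPos n ∧ ∀ k i : ℕ, i ≤ k → k ≤ n → LBtab A k i = Ξ k i}

namespace GZ

open Polynomial

set_option linter.unusedSimpArgs false

theorem det_border_aux {R m : Type*} [CommRing R] [Fintype m] [DecidableEq m]
    (M : Matrix m m R) (u : Matrix m (Fin 1) R) (w : Matrix (Fin 1) m R)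
    (c : Matrix (Fin 1) (Fin 1) R) (hM : IsRegular M.det) :
    (fromBlocks M u w c).det = c 0 0 * M.det - (w * M.adjugate * u) 0 0 := by
  have h : fromBlocks M u w c * fromBlocks 1 (-(M.adjugate * u)) 0 (M.det • 1)
      = fromBlocks M 0 w (M.det • c - w * M.adjugate * u) := by
    rw [fromBlocks_multiply]
    congr 1
    · simp
    · rw [Matrix.mul_neg, ← Matrix.mul_assoc, mul_adjugate]; simp
    · simp
    · simp [Matrix.mul_assoc, sub_eq_neg_add]
  have h2 := congrArg Matrix.det h
  rw [det_mul, det_fromBlocks_zero₂₁, det_fromBlocks_zero₁₂] at h2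
  simp at h2
  rw [mul_comm] at h2
  have := hM.left h2
  rw [this]; ring

theorem det_border {R m : Type*} [CommRing R] [Fintype m] [DecidableEq m]
    (M : Matrix m m R) (u : Matrix m (Fin 1) R) (w : Matrix (Fin 1) m R)
    (c : Matrix (Fin 1) (Fin 1) R) :
    (fromBlocks M u w c).det = c 0 0 * M.det - (w * M.adjugate * u) 0 0 := by
  have h := det_border_aux (charmatrix (-M)) (u.map C) (w.map C) (c.map C)
    (charpoly_monic (-M)).isRegular
  have h2 := congrArg (evalRingHom (0:R)) h
  have e0 : (evalRingHom (0:R)).mapMatrix (charmatrix (-M)) = M := by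
    ext i j
    simp [charmatrix_apply, Matrix.diagonal_apply]
    split_ifs <;> simp
  have eu : (u.map C).map (evalRingHom (0:R)) = u := by ext; simp
  have ew : (w.map C).map (evalRingHom (0:R)) = w := by ext; simp
  have ec : (c.map C).map (evalRingHom (0:R)) = c := by ext; simp
  rw [map_sub, map_mul, RingHom.map_det, RingHom.map_det, e0] at h2
  have e1 : (evalRingHom (0:R)) ((w.map C * (charmatrix (-M)).adjugate * u.map C) 0 0)
      = (w * M.adjugate * u) 0 0 := by
    have := congrFun (congrFun (Matrix.map_mul (L := w.map C * (charmatrix (-M)).adjugate) (M := u.map C) (f := evalRingHom (0:R))) 0) 0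
    rw [Matrix.map_apply] at this
    rw [this, Matrix.map_mul, eu, ew]
    have h3 := RingHom.map_adjugate (evalRingHom (0:R)) (charmatrix (-M))
    rw [e0] at h3
    rw [← h3]; rfl
  rw [e1] at h2
  have e2 : (evalRingHom (0:R)).mapMatrix (fromBlocks (charmatrix (-M)) (u.map C) (w.map C) (c.map C)) = fromBlocks M u w c := by
    rw [RingHom.mapMatrix_apply, fromBlocks_map, eu, ew, ec]
    rw [RingHom.mapMatrix_apply] at e0
    rw [e0]
  rw [e2] at h2
  simpa using h2

/-- The target characteristic polynomial. -/
noncomputable def P {k : ℕ} (μ : Fin k → ℝ) : ℂ[X] := ∏ i, (X - C (μ i : ℂ))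

theorem P_perm_eq {k : ℕ} {f g : Fin k → ℝ} (hf : Antitone f) (hg : Antitone g)
    (h : P f = P g) : f = g := by
  have h1 : ∀ f : Fin k → ℝ, (P f).roots = Multiset.map (fun i => (f i : ℂ)) Finset.univ.val := by
    intro f
    have := Polynomial.roots_multiset_prod_X_sub_C (Multiset.map (fun i => (f i : ℂ)) Finset.univ.val)
    rw [← this, P, Multiset.map_map]; rfl
  have h2 : Multiset.map f Finset.univ.val = Multiset.map g Finset.univ.val := by
    have h3 := (h1 f).symm.trans ((congrArg roots h).trans (h1 g))
    have h4 := congrArg (Multiset.map Complex.re) h3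
    simpa [Multiset.map_map, Function.comp_def] using h4
  rw [Fin.univ_val_map, Fin.univ_val_map, Multiset.coe_eq_coe] at h2
  exact List.ofFn_injective (h2.eq_of_sortedGE hf.sortedGE_ofFn hg.sortedGE_ofFn)

theorem eigsDesc_antitone {n : ℕ} {A : Matrix (Fin n) (Fin n) ℂ} (hA : A.IsHermitian) :
    Antitone (eigsDesc hA) := by
  intro i j hij
  exact Tuple.monotone_sort hA.eigenvalues (Fin.rev_le_rev.mpr hij)

theorem charpoly_eq_P {n : ℕ} {A : Matrix (Fin n) (Fin n) ℂ} (hA : A.IsHermitian) :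
    A.charpoly = P (eigsDesc hA) := by
  rw [hA.charpoly_eq, P]
  exact (Equiv.prod_comp (Fin.revPerm.trans (Tuple.sort hA.eigenvalues))
    (fun i => X - C ((hA.eigenvalues i : ℝ) : ℂ))).symm

theorem det_upper {n : ℕ} {A : Matrix (Fin n) (Fin n) ℂ} (hA : A ∈ UpperTriPos n) :
    A.det ≠ 0 := by
  rw [Matrix.det_of_isUpperTriangular (fun i j h => hA.1 i j h)]
  refine Finset.prod_ne_zero_iff.mpr fun i _ h => ?_
  have := (hA.2 i).1
  rw [h] at this; simp at this

open scoped ComplexOrder in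
theorem posdef_upper {n : ℕ} {A : Matrix (Fin n) (Fin n) ℂ} (hA : A ∈ UpperTriPos n) :
    (A * Aᴴ).PosDef := by
  apply Matrix.PosDef.mul_conjTranspose_self
  rw [Matrix.vecMul_injective_iff_isUnit, Matrix.isUnit_iff_isUnit_det]
  exact isUnit_iff_ne_zero.mpr (det_upper hA)

open scoped ComplexOrder in
theorem eigsDesc_pos {n : ℕ} {A : Matrix (Fin n) (Fin n) ℂ} (hA : A ∈ UpperTriPos n) (i : Fin n) :
    0 < eigsDesc (Matrix.isHermitian_mul_conjTranspose_self A) i :=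
  (posdef_upper hA).eigenvalues_pos _

/-- eigenvalues read off from a tableau row -/
noncomputable def ev (ξ : ℕ → ℝ) (k : ℕ) : Fin k → ℝ :=
  fun i => Real.exp (2 * (ξ (i + 1) - ξ i))

theorem sum_Iic {k : ℕ} (g : ℕ → ℝ) (i : Fin k) :
    ∑ j ∈ Finset.Iic i, g j = ∑ j ∈ Finset.range (i + 1), g j := by
  refine Finset.sum_bij (fun a _ => (a : ℕ)) ?_ ?_ ?_ ?_
  · intro a ha; simp at ha ⊢; omega
  · intro a _ b _ h; exact Fin.ext h
  · intro b hb; simp at hb; exact ⟨⟨b, by omega⟩, by simp [Fin.le_def]; omega, rfl⟩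
  · intros; rfl

theorem lB_iff {k : ℕ} {A : Matrix (Fin k) (Fin k) ℂ} (hA : A ∈ UpperTriPos k) (ξ : ℕ → ℝ)
    (h0 : ξ 0 = 0) (hanti : Antitone (ev ξ k)) :
    (∀ i : Fin k, lB A i = ξ (i + 1)) ↔ (Aᴴ * A).charpoly = P (ev ξ k) := by
  rw [Matrix.charpoly_mul_comm, charpoly_eq_P (Matrix.isHermitian_mul_conjTranspose_self A)]
  set f := eigsDesc (Matrix.isHermitian_mul_conjTranspose_self A) with hf
  constructor
  · intro h
    congr 1
    funext i
    have key : Real.log (f i) = 2 * (ξ (i + 1) - ξ i) := by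
      have hi := h i
      unfold lB at hi
      rw [← hf] at hi
      by_cases hz : (i : ℕ) = 0
      · have : Finset.Iic i = {i} := by
          ext j; simp only [Finset.mem_Iic, Finset.mem_singleton, Fin.le_def, Fin.ext_iff]; omega
        rw [this, Finset.sum_singleton] at hi
        rw [hz] at hi ⊢
        rw [h0]; linarith
      · have hi' := h ⟨i - 1, by omega⟩
        unfold lB at hi'
        rw [← hf] at hi'
        have : Finset.Iic i = insert i (Finset.Iic (⟨i - 1, by omega⟩ : Fin k)) := by
          ext j; simp only [Finset.mem_Iic, Finset.mem_insert, Fin.le_def, Fin.ext_iff]; omega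
        rw [this, Finset.sum_insert (by simp [Fin.le_def]; omega)] at hi
        have e : ((⟨i - 1, by omega⟩ : Fin k) : ℕ) + 1 = i := by simp; omega
        rw [e] at hi'
        linarith
    rw [ev, ← key, Real.exp_log (eigsDesc_pos hA i)]
  · intro h i
    have := P_perm_eq (eigsDesc_antitone _) hanti h
    unfold lB
    rw [this]
    simp only [ev, Real.log_exp]
    rw [sum_Iic (fun j => 2 * (ξ (j + 1) - ξ j)), ← Finset.mul_sum, Finset.sum_range_sub, h0]
    ring

/-- squared moduli of the coordinates of the new column -/
noncomputable def wt {k : ℕ} (μ : Fin k → ℝ) (l : Fin (k + 1) → ℝ) (i : Fin k) : ℝ :=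
  -(∏ j, (μ i - l j)) / ∏ j ∈ Finset.univ.erase i, (μ i - μ j)

/-- strict interlacing -/
def Inter {k : ℕ} (μ : Fin k → ℝ) (l : Fin (k + 1) → ℝ) : Prop :=
  ∀ i : Fin k, μ i < l i.castSucc ∧ l i.succ < μ i

theorem Inter.strictAnti_right {k : ℕ} {μ : Fin k → ℝ} {l : Fin (k + 1) → ℝ} (h : Inter μ l) :
    StrictAnti l :=
  Fin.strictAnti_iff_succ_lt.mpr fun i => (h i).2.trans (h i).1

theorem Inter.strictAnti_left {k : ℕ} {μ : Fin k → ℝ} {l : Fin (k + 1) → ℝ} (h : Inter μ l) :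
    StrictAnti μ := by
  intro i j hij
  calc μ j < l j.castSucc := (h j).1
    _ ≤ l i.succ := h.strictAnti_right.antitone (by rw [Fin.le_def]; simpa using hij)
    _ < μ i := (h i).2

theorem Inter.ne {k : ℕ} {μ : Fin k → ℝ} {l : Fin (k + 1) → ℝ} (h : Inter μ l)
    (i : Fin k) (j : Fin (k + 1)) : l j ≠ μ i := by
  rcases le_or_gt j i.castSucc with hj | hj
  · exact ((h i).1.trans_le (h.strictAnti_right.antitone hj)).ne'
  · exact ((h.strictAnti_right.antitone (Fin.castSucc_lt_iff_succ_le.mp hj)).trans_lt (h i).2).ne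

theorem wt_pos {k : ℕ} {μ : Fin k → ℝ} {l : Fin (k + 1) → ℝ} (h : Inter μ l) (i : Fin k) :
    0 < wt μ l i := by
  unfold wt
  rw [Fin.prod_univ_succAbove _ i.castSucc,
    ← Finset.mul_prod_erase Finset.univ (fun j => μ i - l (i.castSucc.succAbove j))
      (Finset.mem_univ i)]
  have e1 : i.castSucc.succAbove i = i.succ := by simp
  have h1 := (h i).1
  have h2 := (h i).2
  have : 0 < (∏ j ∈ Finset.univ.erase i, (μ i - l (i.castSucc.succAbove j))) /
      ∏ j ∈ Finset.univ.erase i, (μ i - μ j) := by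
    rw [← Finset.prod_div_distrib]
    refine Finset.prod_pos fun j hj => ?_
    have hne : j ≠ i := Finset.ne_of_mem_erase hj
    rcases lt_or_gt_of_ne hne with hlt | hgt
    · rw [Fin.succAbove_of_castSucc_lt _ _ (by simpa using hlt)]
      have a := h.strictAnti_left hlt
      have b := (h j).1
      exact div_pos_of_neg_of_neg (by linarith) (by linarith)
    · rw [Fin.succAbove_of_le_castSucc _ _ (by simpa using hgt.le)]
      have a := h.strictAnti_left hgt
      have b := (h j).2
      exact div_pos (by linarith) (by linarith)
  rw [e1]
  have e2 : ∀ a b c d : ℝ, -(a * (b * c)) / d = (-a * b) * (c / d) := by intros; ring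
  rw [e2]
  have e3 : 0 < -(μ i - l i.castSucc) := by linarith
  have e4 : 0 < μ i - l i.succ := by linarith
  positivity

theorem P_eval {k : ℕ} (μ : Fin k → ℝ) (x : ℂ) : (P μ).eval x = ∏ i, (x - (μ i : ℂ)) := by
  simp [P, eval_prod]

theorem P_monic {k : ℕ} (μ : Fin k → ℝ) : (P μ).Monic :=
  monic_prod_of_monic _ _ fun _ _ => monic_X_sub_C _

theorem P_natDegree {k : ℕ} (μ : Fin k → ℝ) : (P μ).natDegree = k := by
  unfold P; simp [natDegree_prod_of_monic _ _ (fun i _ => monic_X_sub_C (μ i : ℂ))]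

theorem det_of_charpoly {m : Type*} [Fintype m] [DecidableEq m] {M : Matrix m m ℂ} {k : ℕ}
    (hk : Fintype.card m = k) (μ : Fin k → ℝ) :
    M.charpoly.eval 0 = (P μ).eval 0 ↔ M.det = ∏ i, (μ i : ℂ) := by
  rw [eval_charpoly, P_eval]
  simp only [map_zero, zero_sub]
  rw [det_neg, hk, Finset.prod_neg]
  simp

/-- `U` is a unitary frame of eigenvectors of `Aᴴ A`. -/
def Frame {k : ℕ} (μ : Fin k → ℝ) (A U : Matrix (Fin k) (Fin k) ℂ) : Prop :=
  Uᴴ * U = 1 ∧ (Aᴴ * A) * U = U * diagonal (fun i => (μ i : ℂ))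

theorem Frame.gram {k : ℕ} {μ : Fin k → ℝ} {A U : Matrix (Fin k) (Fin k) ℂ} (h : Frame μ A U) :
    (A * U)ᴴ * (A * U) = diagonal (fun i => (μ i : ℂ)) := by
  rw [conjTranspose_mul, Matrix.mul_assoc, ← Matrix.mul_assoc Aᴴ, h.2, ← Matrix.mul_assoc, h.1,
    Matrix.one_mul]

theorem eval_at_mu {k : ℕ} {μ : Fin k → ℝ} {A U : Matrix (Fin k) (Fin k) ℂ} (h : Frame μ A U)
    (b : Matrix (Fin k) (Fin 1) ℂ) (d : Matrix (Fin 1) (Fin 1) ℂ) (i : Fin k) :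
    ((fromBlocks A b 0 d)ᴴ * fromBlocks A b 0 d).charpoly.eval (μ i : ℂ) =
      -((‖((A * U)ᴴ * b) i 0‖ ^ 2 : ℝ) : ℂ) * ∏ j ∈ Finset.univ.erase i, ((μ i : ℂ) - μ j) := by
  set B := fromBlocks A b 0 d with hB
  set V : Matrix (Fin k ⊕ Fin 1) (Fin k ⊕ Fin 1) ℂ := fromBlocks U 0 0 1 with hV
  have hUU : U * Uᴴ = 1 := mul_eq_one_comm.mp h.1
  have hVV : V * Vᴴ = 1 := by
    rw [hV, fromBlocks_conjTranspose, fromBlocks_multiply]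
    simp [hUU]
  have h1 : (Bᴴ * B).charpoly = ((B * V)ᴴ * (B * V)).charpoly := by
    rw [conjTranspose_mul, Matrix.mul_assoc, charpoly_mul_comm Vᴴ, Matrix.mul_assoc,
      Matrix.mul_assoc, hVV, Matrix.mul_one]
  have hBV : B * V = fromBlocks (A * U) b 0 d := by
    rw [hB, hV, fromBlocks_multiply]; simp
  rw [h1, hBV, fromBlocks_conjTranspose, fromBlocks_multiply, h.gram, eval_charpoly]
  simp only [conjTranspose_zero, Matrix.mul_zero, Matrix.zero_mul, add_zero]
  set G := A * U
  have e : scalar (Fin k ⊕ Fin 1) (μ i : ℂ) - fromBlocks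
      (diagonal (fun i => (μ i : ℂ))) (Gᴴ * b) (bᴴ * G) (bᴴ * b + dᴴ * d)
      = fromBlocks (diagonal (fun j => (μ i : ℂ) - μ j)) (-(Gᴴ * b)) (-(bᴴ * G))
        (scalar (Fin 1) (μ i : ℂ) - (bᴴ * b + dᴴ * d)) := by
    ext p q
    rcases p with p | p <;> rcases q with q | q <;>
      simp [Matrix.diagonal_apply]
    split_ifs <;> simp
  rw [e, det_border, adjugate_diagonal]
  have hz : (diagonal (fun j => (μ i : ℂ) - μ j)).det = 0 := by
    rw [det_diagonal]; exact Finset.prod_eq_zero (Finset.mem_univ i) (by simp)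
  rw [hz, mul_zero, zero_sub, Matrix.mul_apply]
  rw [Finset.sum_eq_single i]
  · rw [Matrix.mul_diagonal]
    have e3 : (bᴴ * G) 0 i = star ((Gᴴ * b) i 0) := by
      rw [← conjTranspose_apply, conjTranspose_mul, conjTranspose_conjTranspose]
    simp only [Matrix.neg_apply, e3]
    have : ((‖(Gᴴ * b) i 0‖ ^ 2 : ℝ) : ℂ) = star ((Gᴴ * b) i 0) * (Gᴴ * b) i 0 := by
      have := Complex.conj_mul' ((Gᴴ * b) i 0)
      push_cast
      exact this.symm
    rw [this]; ring
  · intro j _ hj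
    rw [Matrix.mul_diagonal]
    have : ∏ x ∈ Finset.univ.erase j, ((μ i : ℂ) - μ x) = 0 :=
      Finset.prod_eq_zero (i := i) (by simp [hj.symm]) (by simp)
    rw [this]; simp
  · simp

theorem core_iff {k : ℕ} {μ : Fin k → ℝ} {l : Fin (k + 1) → ℝ} {A U : Matrix (Fin k) (Fin k) ℂ}
    (h : Frame μ A U) (hA : (Aᴴ * A).charpoly = P μ) (hinj : Function.Injective μ)
    (hμ : ∀ i, 0 < μ i)
    (b : Matrix (Fin k) (Fin 1) ℂ) (d : Matrix (Fin 1) (Fin 1) ℂ) :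
    ((fromBlocks A b 0 d)ᴴ * fromBlocks A b 0 d).charpoly = P l ↔
      (∀ i, ‖((A * U)ᴴ * b) i 0‖ ^ 2 = wt μ l i) ∧ (∏ i, μ i) * ‖d 0 0‖ ^ 2 = ∏ j, l j := by
  set B := fromBlocks A b 0 d with hB
  have hprod : ∀ i, ∏ j ∈ Finset.univ.erase i, (μ i - μ j) ≠ 0 := fun i =>
    Finset.prod_ne_zero_iff.mpr fun j hj =>
      sub_ne_zero.mpr fun hh => Finset.ne_of_mem_erase hj (hinj hh).symm
  have hi : ∀ i, (Bᴴ * B).charpoly.eval (μ i : ℂ) = (P l).eval (μ i : ℂ) ↔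
      ‖((A * U)ᴴ * b) i 0‖ ^ 2 = wt μ l i := by
    intro i
    rw [eval_at_mu h, P_eval, wt, eq_div_iff (hprod i)]
    rw [← Complex.ofReal_inj]
    push_cast
    constructor <;> intro hh <;> linear_combination -hh
  have hd : (Bᴴ * B).charpoly.eval 0 = (P l).eval 0 ↔ (∏ i, μ i) * ‖d 0 0‖ ^ 2 = ∏ j, l j := by
    rw [det_of_charpoly (by simp)]
    have h1 : (Aᴴ * A).det = ∏ i, (μ i : ℂ) := (det_of_charpoly (by simp) μ).mp (by rw [hA])
    rw [det_mul, det_conjTranspose] at h1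
    rw [det_mul, det_conjTranspose, hB, det_fromBlocks_zero₂₁]
    have h2 : star (A.det * d.det) * (A.det * d.det) = (∏ i, (μ i : ℂ)) * (‖d 0 0‖ : ℂ) ^ 2 := by
      rw [← h1, ← Complex.conj_mul', star_mul]
      simp
      ring
    rw [h2, ← Complex.ofReal_inj]
    push_cast
    rfl
  constructor
  · intro hh
    exact ⟨fun i => (hi i).mp (by rw [hh]), hd.mp (by rw [hh])⟩
  · rintro ⟨h1, h2⟩
    let v : Option (Fin k) → ℂ := fun o => o.elim 0 (fun i => (μ i : ℂ))
    have hm : (Bᴴ * B).charpoly.Monic := charpoly_monic _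
    have hdeg : (Bᴴ * B).charpoly.degree = (P l).degree := by
      rw [degree_eq_natDegree hm.ne_zero, degree_eq_natDegree (P_monic l).ne_zero, P_natDegree,
        charpoly_natDegree_eq_dim]; simp
    refine eq_of_degree_sub_lt_of_eval_index_eq (v := v) Finset.univ ?_ ?_ ?_
    · intro x _ y _ hxy
      rcases x with _ | x <;> rcases y with _ | y
      · rfl
      · exact absurd hxy.symm (by simpa [v] using (hμ y).ne')
      · exact absurd hxy (by simpa [v] using (hμ x).ne')
      · simp only [v, Option.elim, Complex.ofReal_inj] at hxy
        rw [hinj hxy]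
    · refine (degree_sub_lt_left hdeg hm.ne_zero ?_).trans_le ?_
      · rw [hm.leadingCoeff, (P_monic l).leadingCoeff]
      · rw [degree_eq_natDegree hm.ne_zero, charpoly_natDegree_eq_dim]; simp
    · rintro (_ | i) _
      · exact hd.mpr h2
      · exact (hi i).mpr (h1 i)

/-- top-left block -/
def tl {k : ℕ} (A : Matrix (Fin (k + 1)) (Fin (k + 1)) ℂ) : Matrix (Fin k) (Fin k) ℂ :=
  A.submatrix Fin.castSucc Fin.castSucc

/-- last column without its last entry -/
def colb {k : ℕ} (A : Matrix (Fin (k + 1)) (Fin (k + 1)) ℂ) : Matrix (Fin k) (Fin 1) ℂ :=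
  of fun i _ => A i.castSucc (Fin.last k)

/-- last diagonal entry -/
def dd {k : ℕ} (A : Matrix (Fin (k + 1)) (Fin (k + 1)) ℂ) : Matrix (Fin 1) (Fin 1) ℂ :=
  of fun _ _ => A (Fin.last k) (Fin.last k)

/-- reassemble -/
def bord {k : ℕ} (A : Matrix (Fin k) (Fin k) ℂ) (b : Matrix (Fin k) (Fin 1) ℂ)
    (d : Matrix (Fin 1) (Fin 1) ℂ) : Matrix (Fin (k + 1)) (Fin (k + 1)) ℂ :=
  (fromBlocks A b 0 d).submatrix finSumFinEquiv.symm finSumFinEquiv.symm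

theorem es_castSucc {k : ℕ} (i : Fin k) :
    (finSumFinEquiv (m := k) (n := 1)).symm i.castSucc = Sum.inl i := by
  rw [Equiv.symm_apply_eq]; rfl

theorem es_last {k : ℕ} : (finSumFinEquiv (m := k) (n := 1)).symm (Fin.last k) = Sum.inr 0 := by
  rw [Equiv.symm_apply_eq]; rfl

theorem tl_bord {k : ℕ} (A : Matrix (Fin k) (Fin k) ℂ) (b : Matrix (Fin k) (Fin 1) ℂ)
    (d : Matrix (Fin 1) (Fin 1) ℂ) : tl (bord A b d) = A := by
  ext i j; simp only [tl, bord, submatrix_apply, es_castSucc, fromBlocks_apply₁₁]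

theorem colb_bord {k : ℕ} (A : Matrix (Fin k) (Fin k) ℂ) (b : Matrix (Fin k) (Fin 1) ℂ)
    (d : Matrix (Fin 1) (Fin 1) ℂ) : colb (bord A b d) = b := by
  ext i j
  simp only [colb, bord, submatrix_apply, es_castSucc, es_last, of_apply, fromBlocks_apply₁₂]
  rw [Subsingleton.elim 0 j]

theorem bord_eq {k : ℕ} {A : Matrix (Fin (k + 1)) (Fin (k + 1)) ℂ} (hA : A ∈ UpperTriPos (k + 1)) :
    bord (tl A) (colb A) (dd A) = A := by
  ext i j
  induction i using Fin.lastCases with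
  | last =>
    induction j using Fin.lastCases with
    | last => simp [bord, es_last, dd]
    | cast j => simp [bord, es_last, es_castSucc, hA.1 _ _ (Fin.castSucc_lt_last j)]
  | cast i =>
    induction j using Fin.lastCases with
    | last => simp [bord, es_last, es_castSucc, colb]
    | cast j => simp [bord, es_castSucc, tl]

theorem bord_gram {k : ℕ} (A : Matrix (Fin k) (Fin k) ℂ) (b : Matrix (Fin k) (Fin 1) ℂ)
    (d : Matrix (Fin 1) (Fin 1) ℂ) : (bord A b d)ᴴ * bord A b d =
    ((fromBlocks A b 0 d)ᴴ * fromBlocks A b 0 d).submatrix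
      finSumFinEquiv.symm finSumFinEquiv.symm := by
  rw [bord, conjTranspose_submatrix, submatrix_mul_equiv]

theorem bord_charpoly {k : ℕ} (A : Matrix (Fin k) (Fin k) ℂ) (b : Matrix (Fin k) (Fin 1) ℂ)
    (d : Matrix (Fin 1) (Fin 1) ℂ) : ((bord A b d)ᴴ * bord A b d).charpoly =
    ((fromBlocks A b 0 d)ᴴ * fromBlocks A b 0 d).charpoly := by
  rw [bord_gram]
  have h := charpoly_reindex (finSumFinEquiv (m := k) (n := 1))
    ((fromBlocks A b 0 d)ᴴ * fromBlocks A b 0 d)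
  rw [reindex_apply] at h
  convert h using 2

theorem bord_mem {k : ℕ} {A : Matrix (Fin k) (Fin k) ℂ} (hA : A ∈ UpperTriPos k)
    (b : Matrix (Fin k) (Fin 1) ℂ) (d : Matrix (Fin 1) (Fin 1) ℂ)
    (hd : 0 < (d 0 0).re ∧ (d 0 0).im = 0) : bord A b d ∈ UpperTriPos (k + 1) := by
  constructor
  · intro i j hij
    induction i using Fin.lastCases with
    | last =>
      induction j using Fin.lastCases with
      | last => exact absurd hij (lt_irrefl _)
      | cast j => simp [bord, es_last, es_castSucc]
    | cast i =>
      induction j using Fin.lastCases with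
      | last => exact absurd hij (not_lt.mpr (Fin.castSucc_lt_last i).le)
      | cast j => simpa [bord, es_castSucc] using hA.1 i j (by simpa using hij)
  · intro i
    induction i using Fin.lastCases with
    | last => simpa [bord, es_last] using hd
    | cast i => simpa [bord, es_castSucc] using hA.2 i

theorem tl_mem {k : ℕ} {A : Matrix (Fin (k + 1)) (Fin (k + 1)) ℂ} (hA : A ∈ UpperTriPos (k + 1)) :
    tl A ∈ UpperTriPos k :=
  ⟨fun i j h => hA.1 _ _ (by simpa using h), fun i => hA.2 _⟩

theorem mem_fiber_succ {k : ℕ} {Ξ : ℕ → ℕ → ℝ} (h0 : Ξ (k + 1) 0 = 0)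
    (A : Matrix (Fin (k + 1)) (Fin (k + 1)) ℂ) :
    A ∈ LBfiber (k + 1) Ξ ↔ A ∈ UpperTriPos (k + 1) ∧ tl A ∈ LBfiber k Ξ ∧
      ∀ i : Fin (k + 1), lB A i = Ξ (k + 1) (i + 1) := by
  have e1 : ∀ j i, i ≤ j → j ≤ k → LBtab A j i = LBtab (tl A) j i := by
    intro j i hij hj
    unfold LBtab
    by_cases h : 1 ≤ i
    · rw [dif_pos ⟨h, hij, hj.trans (Nat.le_succ k)⟩, dif_pos ⟨h, hij, hj⟩]; rfl
    · rw [dif_neg (by tauto), dif_neg (by tauto)]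
  have e2 : ∀ i : Fin (k + 1), LBtab A (k + 1) (i + 1) = lB A i := by
    intro i
    unfold LBtab
    rw [dif_pos ⟨by omega, by omega, le_rfl⟩]; rfl
  constructor
  · rintro ⟨hU, h⟩
    exact ⟨hU, ⟨tl_mem hU, fun j i hij hj => by rw [← e1 j i hij hj]; exact h j i hij (by omega)⟩,
      fun i => by rw [← e2]; exact h _ _ (by omega) le_rfl⟩
  · rintro ⟨hU, h, h'⟩
    refine ⟨hU, fun j i hij hj => ?_⟩
    rcases Nat.lt_or_ge k j with hk | hk
    · obtain rfl : j = k + 1 := by omega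
      rcases i with _ | i
      · rw [h0]; unfold LBtab; rw [dif_neg (by omega)]
      · rw [← h' ⟨i, by omega⟩, ← e2]
    · rw [e1 j i hij hk]; exact h.2 j i hij hk

/-- the hypotheses on the tableau -/
structure Hyp (n : ℕ) (Ξ : ℕ → ℕ → ℝ) : Prop where
  h0 : ∀ k ≤ n, Ξ k 0 = 0
  hs : ∀ k i : ℕ, 1 ≤ i → i ≤ k → k < n →
      Ξ (k + 1) i + Ξ k (i - 1) > Ξ (k + 1) (i - 1) + Ξ k i ∧
      Ξ (k + 1) i + Ξ k i > Ξ (k + 1) (i + 1) + Ξ k (i - 1)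

theorem Hyp.inter {n : ℕ} {Ξ : ℕ → ℕ → ℝ} (h : Hyp n Ξ) {k : ℕ} (hk : k < n) :
    Inter (ev (Ξ k) k) (ev (Ξ (k + 1)) (k + 1)) := by
  intro i
  obtain ⟨h1, h2⟩ := h.hs k (i + 1) (by omega) (by omega) hk
  simp only [Nat.add_sub_cancel] at h1 h2
  constructor
  · simp only [ev, Real.exp_lt_exp, Fin.val_castSucc]; linarith
  · simp only [ev, Real.exp_lt_exp, Fin.val_succ]; linarith

theorem Hyp.anti {n : ℕ} {Ξ : ℕ → ℕ → ℝ} (h : Hyp n Ξ) {k : ℕ} (hk : k ≤ n) :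
    StrictAnti (ev (Ξ k) k) := by
  rcases k with _ | k
  · intro i; exact i.elim0
  · exact (h.inter hk).strictAnti_right

theorem ev_pos (ξ : ℕ → ℝ) (k : ℕ) (i : Fin k) : 0 < ev ξ k i := Real.exp_pos _

theorem Hyp.mem_succ {n : ℕ} {Ξ : ℕ → ℕ → ℝ} (h : Hyp n Ξ) {k : ℕ} (hk : k < n)
    (A : Matrix (Fin (k + 1)) (Fin (k + 1)) ℂ) :
    A ∈ LBfiber (k + 1) Ξ ↔ A ∈ UpperTriPos (k + 1) ∧ tl A ∈ LBfiber k Ξ ∧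
      (Aᴴ * A).charpoly = P (ev (Ξ (k + 1)) (k + 1)) := by
  rw [mem_fiber_succ (h.h0 _ hk)]
  refine and_congr_right fun hU => and_congr_right fun _ => ?_
  exact lB_iff hU _ (h.h0 _ hk) (h.anti hk).antitone

theorem Hyp.charpoly {n : ℕ} {Ξ : ℕ → ℕ → ℝ} (h : Hyp n Ξ) {k : ℕ} (hk : k ≤ n)
    {A : Matrix (Fin k) (Fin k) ℂ} (hA : A ∈ LBfiber k Ξ) :
    (Aᴴ * A).charpoly = P (ev (Ξ k) k) := by
  rcases k with _ | k
  · simp [P, Matrix.charpoly]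
  · exact ((h.mem_succ hk A).mp hA).2.2

theorem frame_normalize {k : ℕ} {l : Fin k → ℝ} (hl : Function.Injective l)
    {A Y : Matrix (Fin k) (Fin k) ℂ} (hY : (Aᴴ * A) * Y = Y * diagonal (fun i => (l i : ℂ)))
    (hne : ∀ j, ∑ p, ‖Y p j‖ ^ 2 ≠ 0) :
    Frame l A (of fun i j => Y i j / (√(∑ p, ‖Y p j‖ ^ 2) : ℝ)) := by
  have key : diagonal (fun i => (l i : ℂ)) * (Yᴴ * Y) = (Yᴴ * Y) * diagonal (fun i => (l i : ℂ)) := by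
    have h1 : ((Aᴴ * A) * Y)ᴴ = diagonal (fun i => (l i : ℂ)) * Yᴴ := by
      rw [hY, conjTranspose_mul, diagonal_conjTranspose]
      congr 2
      funext i; simp
    rw [← Matrix.mul_assoc, ← h1, Matrix.mul_assoc Yᴴ, ← hY]
    simp [conjTranspose_mul, Matrix.mul_assoc]
  have off : ∀ i j, i ≠ j → (Yᴴ * Y) i j = 0 := by
    intro i j hij
    have := congrFun (congrFun key i) j
    rw [diagonal_mul, mul_diagonal] at this
    have h2 : ((l i : ℂ) - l j) * (Yᴴ * Y) i j = 0 := by linear_combination this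
    rcases mul_eq_zero.mp h2 with h3 | h3
    · exact absurd (hl (by exact_mod_cast sub_eq_zero.mp h3)) hij
    · exact h3
  have on : ∀ j, (Yᴴ * Y) j j = ((∑ p, ‖Y p j‖ ^ 2 : ℝ) : ℂ) := by
    intro j
    rw [Matrix.mul_apply]
    push_cast
    exact Finset.sum_congr rfl fun p _ => Complex.conj_mul' _
  have hU : (of fun i j => Y i j / (√(∑ p, ‖Y p j‖ ^ 2) : ℝ) : Matrix (Fin k) (Fin k) ℂ) =
      Y * diagonal (fun j => (((√(∑ p, ‖Y p j‖ ^ 2))⁻¹ : ℝ) : ℂ)) := by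
    ext i j
    rw [mul_diagonal, of_apply, div_eq_mul_inv, Complex.ofReal_inv]
  rw [hU]
  constructor
  · rw [conjTranspose_mul, diagonal_conjTranspose, Matrix.mul_assoc, ← Matrix.mul_assoc Yᴴ]
    ext i j
    rw [diagonal_mul, mul_diagonal]
    by_cases hij : i = j
    · subst hij
      rw [on, Matrix.one_apply_eq]
      have h1 : 0 ≤ ∑ p, ‖Y p i‖ ^ 2 := Finset.sum_nonneg fun _ _ => by positivity
      have h2 : √(∑ p, ‖Y p i‖ ^ 2) ≠ 0 := Real.sqrt_ne_zero'.mpr (lt_of_le_of_ne h1 (hne i).symm)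
      rw [Pi.star_apply, Complex.star_def, Complex.conj_ofReal]
      have h3 := Real.sq_sqrt h1
      norm_cast
      field_simp
      exact h3.symm
    · rw [off i j hij, Matrix.one_apply_ne hij]; simp
  · rw [← Matrix.mul_assoc, hY, Matrix.mul_assoc, Matrix.mul_assoc, diagonal_mul_diagonal,
      diagonal_mul_diagonal]
    congr 2
    funext i; ring

/-- unnormalised eigenvector of a bordered matrix -/
noncomputable def yv {k : ℕ} (H : Matrix (Fin k) (Fin k) ℂ) (v : Matrix (Fin k) (Fin 1) ℂ) (x : ℂ) :
    Matrix (Fin k ⊕ Fin 1) (Fin 1) ℂ :=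
  fromRows ((scalar (Fin k) x - H).adjugate * v) ((scalar (Fin k) x - H).det • 1)

theorem yv_eig {k : ℕ} (H : Matrix (Fin k) (Fin k) ℂ) (v : Matrix (Fin k) (Fin 1) ℂ)
    (w : Matrix (Fin 1) (Fin k) ℂ) (c : Matrix (Fin 1) (Fin 1) ℂ) (x : ℂ)
    (h : (fromBlocks H v w c).charpoly.eval x = 0) :
    fromBlocks H v w c * yv H v x = x • yv H v x := by
  set S := scalar (Fin k) x - H with hS
  have hdet : (x - c 0 0) * S.det - (w * S.adjugate * v) 0 0 = 0 := by
    rw [eval_charpoly] at h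
    have e : scalar (Fin k ⊕ Fin 1) x - fromBlocks H v w c =
        fromBlocks S (-v) (-w) (scalar (Fin 1) x - c) := by
      ext p q
      rcases p with p | p <;> rcases q with q | q <;> simp [hS, Matrix.diagonal_apply]
    rw [e, det_border] at h
    simpa using h
  have hH : H = scalar (Fin k) x - S := by rw [hS]; abel
  have h1 : H * (S.adjugate * v) + v * (S.det • (1 : Matrix (Fin 1) (Fin 1) ℂ)) =
      x • (S.adjugate * v) := by
    rw [← Matrix.mul_assoc]
    conv_lhs => rw [hH]
    rw [sub_mul, mul_adjugate, Matrix.sub_mul]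
    simp [Matrix.smul_mul]
    rw [← Matrix.smul_eq_diagonal_mul]
    ext i j
    simp [Matrix.mul_apply, Finset.mul_sum, mul_assoc]
  have h2 : w * (S.adjugate * v) + c * (S.det • (1 : Matrix (Fin 1) (Fin 1) ℂ)) =
      x • (S.det • (1 : Matrix (Fin 1) (Fin 1) ℂ)) := by
    ext i j
    obtain rfl : i = 0 := Subsingleton.elim _ _
    obtain rfl : j = 0 := Subsingleton.elim _ _
    rw [← Matrix.mul_assoc]
    simp
    linear_combination -hdet
  rw [yv, fromBlocks_mul_fromRows, ← hS, h1, h2]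
  ext p q
  rcases p with p | p <;> simp

/-- unnormalised matrix of eigenvectors -/
noncomputable def Ym {k : ℕ} (l : Fin (k + 1) → ℝ) (A : Matrix (Fin (k + 1)) (Fin (k + 1)) ℂ) :
    Matrix (Fin (k + 1)) (Fin (k + 1)) ℂ :=
  of fun i j => yv ((tl A)ᴴ * tl A) ((tl A)ᴴ * colb A) (l j : ℂ) (finSumFinEquiv.symm i) 0

theorem Ym_eig {k : ℕ} {l : Fin (k + 1) → ℝ} {A : Matrix (Fin (k + 1)) (Fin (k + 1)) ℂ}
    (hA : A ∈ UpperTriPos (k + 1)) (h : (Aᴴ * A).charpoly = P l) :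
    (Aᴴ * A) * Ym l A = Ym l A * diagonal (fun i => (l i : ℂ)) := by
  rw [← bord_eq hA, bord_charpoly] at h
  have hB : (fromBlocks (tl A) (colb A) 0 (dd A))ᴴ * fromBlocks (tl A) (colb A) 0 (dd A) =
      fromBlocks ((tl A)ᴴ * tl A) ((tl A)ᴴ * colb A) ((colb A)ᴴ * tl A)
        ((colb A)ᴴ * colb A + (dd A)ᴴ * dd A) := by
    rw [fromBlocks_conjTranspose, fromBlocks_multiply]
    simp
  ext i j
  rw [mul_diagonal]
  have h1 := yv_eig ((tl A)ᴴ * tl A) ((tl A)ᴴ * colb A) ((colb A)ᴴ * tl A)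
        ((colb A)ᴴ * colb A + (dd A)ᴴ * dd A) (l j : ℂ) (by
      rw [← hB, h, P_eval]; exact Finset.prod_eq_zero (Finset.mem_univ j) (by simp))
  have h2 := congrFun (congrFun h1 (finSumFinEquiv.symm i)) 0
  rw [← hB] at h2
  have h3 : Aᴴ * A = ((fromBlocks (tl A) (colb A) 0 (dd A))ᴴ *
      fromBlocks (tl A) (colb A) 0 (dd A)).submatrix finSumFinEquiv.symm finSumFinEquiv.symm := by
    rw [← bord_gram, bord_eq hA]
  rw [h3, Matrix.mul_apply]
  rw [Matrix.mul_apply, ← Equiv.sum_comp finSumFinEquiv.symm] at h2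
  rw [Matrix.smul_apply, smul_eq_mul, mul_comm] at h2
  exact h2

theorem continuous_tl {k : ℕ} : Continuous (tl (k := k)) :=
  continuous_id.matrix_submatrix _ _

theorem continuous_colb {k : ℕ} : Continuous (colb (k := k)) :=
  continuous_matrix fun _ _ => continuous_id.matrix_elem _ _

theorem continuous_Ym {k : ℕ} (l : Fin (k + 1) → ℝ) : Continuous (Ym l) := by
  have c1 : Continuous fun A : Matrix (Fin (k + 1)) (Fin (k + 1)) ℂ => (tl A)ᴴ * tl A :=
    continuous_tl.matrix_conjTranspose.matrix_mul continuous_tl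
  have c2 : Continuous fun A : Matrix (Fin (k + 1)) (Fin (k + 1)) ℂ => (tl A)ᴴ * colb A :=
    continuous_tl.matrix_conjTranspose.matrix_mul continuous_colb
  refine continuous_matrix fun i j => ?_
  have c3 : Continuous fun A : Matrix (Fin (k + 1)) (Fin (k + 1)) ℂ =>
    scalar (Fin k) (l j : ℂ) - (tl A)ᴴ * tl A := continuous_const.sub c1
  simp only [Ym, of_apply, yv]
  rcases finSumFinEquiv.symm i with p | p
  · exact (c3.matrix_adjugate.matrix_mul c2).matrix_elem p 0
  · simp only [fromRows_apply_inr, Matrix.smul_apply]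
    exact c3.matrix_det.smul continuous_const

theorem Ym_last {k : ℕ} {μ : Fin k → ℝ} {l : Fin (k + 1) → ℝ} (hi : Inter μ l)
    {A : Matrix (Fin (k + 1)) (Fin (k + 1)) ℂ}
    (h : ((tl A)ᴴ * tl A).charpoly = P μ) (j : Fin (k + 1)) : Ym l A (Fin.last k) j ≠ 0 := by
  simp only [Ym, of_apply, es_last, yv, fromRows_apply_inr, Matrix.smul_apply,
    Matrix.one_apply_eq, smul_eq_mul, mul_one]
  rw [← eval_charpoly, h, P_eval]
  refine Finset.prod_ne_zero_iff.mpr fun i _ => sub_ne_zero.mpr ?_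
  exact_mod_cast hi.ne i j

theorem frame_exists {n : ℕ} {Ξ : ℕ → ℕ → ℝ} (h : Hyp n Ξ) {k : ℕ} (hk : k ≤ n) :
    ∃ U : LBfiber k Ξ → Matrix (Fin k) (Fin k) ℂ, Continuous U ∧
      ∀ A, Frame (ev (Ξ k) k) A.1 (U A) := by
  rcases k with _ | k
  · exact ⟨fun _ => 0, continuous_const, fun A => ⟨Subsingleton.elim _ _, Subsingleton.elim _ _⟩⟩
  set l := ev (Ξ (k + 1)) (k + 1)
  have hne : ∀ (A : LBfiber (k + 1) Ξ) j, ∑ p, ‖Ym l A.1 p j‖ ^ 2 ≠ 0 := by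
    intro A j
    have hA := (h.mem_succ hk A.1).mp A.2
    have h1 := Ym_last (h.inter hk) (h.charpoly (by omega) hA.2.1) j
    refine (Finset.sum_pos' (fun _ _ => by positivity) ⟨Fin.last k, Finset.mem_univ _, ?_⟩).ne'
    have := norm_pos_iff.mpr h1
    positivity
  have cY : Continuous fun A : LBfiber (k + 1) Ξ => Ym l A.1 :=
    (continuous_Ym l).comp continuous_subtype_val
  refine ⟨fun A => of fun i j => Ym l A.1 i j / (√(∑ p, ‖Ym l A.1 p j‖ ^ 2) : ℝ), ?_, ?_⟩
  · refine continuous_matrix fun i j => ?_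
    refine (cY.matrix_elem i j).div ?_ ?_
    · refine Complex.continuous_ofReal.comp (Real.continuous_sqrt.comp ?_)
      exact continuous_finsetSum _ fun p _ => ((cY.matrix_elem p j).norm.pow 2)
    · intro A
      have h1 : 0 ≤ ∑ p, ‖Ym l A.1 p j‖ ^ 2 := Finset.sum_nonneg fun _ _ => by positivity
      exact_mod_cast Real.sqrt_ne_zero'.mpr (lt_of_le_of_ne h1 (hne A j).symm)
  · intro A
    have hA := (h.mem_succ hk A.1).mp A.2
    exact frame_normalize (h.anti hk).injective (Ym_eig hA.1 hA.2.2) (hne A)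

theorem Frame.inv {k : ℕ} {μ : Fin k → ℝ} (hμ : ∀ i, 0 < μ i) {A U : Matrix (Fin k) (Fin k) ℂ}
    (h : Frame μ A U) :
    (A * U) * (diagonal (fun i => ((μ i : ℂ))⁻¹) * (A * U)ᴴ) = 1 := by
  apply mul_eq_one_comm.mp
  rw [Matrix.mul_assoc, h.gram, diagonal_mul_diagonal, ← diagonal_one]
  congr 1
  funext i
  exact inv_mul_cancel₀ (by exact_mod_cast (hμ i).ne')

theorem Frame.inv' {k : ℕ} {μ : Fin k → ℝ} (hμ : ∀ i, 0 < μ i) {A U : Matrix (Fin k) (Fin k) ℂ}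
    (h : Frame μ A U) :
    (A * U)ᴴ * ((A * U) * diagonal (fun i => ((μ i : ℂ))⁻¹)) = 1 := by
  rw [← Matrix.mul_assoc, h.gram, diagonal_mul_diagonal, ← diagonal_one]
  congr 1
  funext i
  exact mul_inv_cancel₀ (by exact_mod_cast (hμ i).ne')

theorem continuous_bord {X : Type*} [TopologicalSpace X] {k : ℕ}
    {A : X → Matrix (Fin k) (Fin k) ℂ} {b : X → Matrix (Fin k) (Fin 1) ℂ}
    {d : Matrix (Fin 1) (Fin 1) ℂ} (hA : Continuous A) (hb : Continuous b) :
    Continuous fun x => bord (A x) (b x) d :=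
  (hA.matrix_fromBlocks hb continuous_const continuous_const).matrix_submatrix _ _

theorem step {n : ℕ} {Ξ : ℕ → ℕ → ℝ} (h : Hyp n Ξ) {k : ℕ} (hk : k < n) :
    Nonempty (LBfiber (k + 1) Ξ ≃ₜ LBfiber k Ξ × (Fin k → Circle)) := by
  obtain ⟨U, cU, hU⟩ := frame_exists h hk.le
  set μ := ev (Ξ k) k with hμdef
  set l := ev (Ξ (k + 1)) (k + 1) with hldef
  have hμ : ∀ i, 0 < μ i := ev_pos _ _
  have hl : ∀ i, 0 < l i := ev_pos _ _
  have hinj : Function.Injective μ := (h.anti hk.le).injective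
  have hw : ∀ i, 0 < wt μ l i := wt_pos (h.inter hk)
  have hsw : ∀ i, 0 < √(wt μ l i) := fun i => Real.sqrt_pos.mpr (hw i)
  have hPμ : 0 < ∏ i, μ i := Finset.prod_pos fun i _ => hμ i
  have hPl : 0 < ∏ i, l i := Finset.prod_pos fun i _ => hl i
  set d0 : ℝ := √((∏ j, l j) / ∏ i, μ i) with hd0
  have hd0pos : 0 < d0 := Real.sqrt_pos.mpr (by positivity)
  have hd0sq : (∏ i, μ i) * d0 ^ 2 = ∏ j, l j := by
    rw [hd0, Real.sq_sqrt (by positivity)]; field_simp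
  set D0 : Matrix (Fin 1) (Fin 1) ℂ := of fun _ _ => (d0 : ℂ) with hD0
  have fib : ∀ A : LBfiber (k + 1) Ξ, A.1 ∈ UpperTriPos (k + 1) ∧ tl A.1 ∈ LBfiber k Ξ ∧
      (A.1ᴴ * A.1).charpoly = P l := fun A => (h.mem_succ hk A.1).mp A.2
  let T : LBfiber (k + 1) Ξ → LBfiber k Ξ := fun A => ⟨tl A.1, (fib A).2.1⟩
  have cT : Continuous T := (continuous_tl.comp continuous_subtype_val).subtype_mk _
  let a : LBfiber (k + 1) Ξ → Matrix (Fin k) (Fin 1) ℂ :=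
    fun A => ((T A).1 * U (T A))ᴴ * colb A.1
  have ca : Continuous a :=
    (((continuous_subtype_val.comp cT).matrix_mul (cU.comp cT)).matrix_conjTranspose).matrix_mul
      (continuous_colb.comp continuous_subtype_val)
  have core : ∀ A : LBfiber (k + 1) Ξ, (∀ i, ‖a A i 0‖ ^ 2 = wt μ l i) ∧ dd A.1 = D0 := by
    intro A
    obtain ⟨h1, h2, h3⟩ := fib A
    rw [← bord_eq h1, bord_charpoly,
      core_iff (hU (T A)) (h.charpoly hk.le h2) hinj hμ] at h3
    refine ⟨h3.1, ?_⟩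
    ext i j
    have h4 := h1.2 (Fin.last k)
    have h5 : dd A.1 0 0 = ((A.1 (Fin.last k) (Fin.last k)).re : ℂ) := by
      apply Complex.ext <;> simp [dd, h4.2]
    have h6 : ‖dd A.1 0 0‖ ^ 2 = d0 ^ 2 :=
      mul_left_cancel₀ hPμ.ne' (h3.2.trans hd0sq.symm)
    rw [h5, Complex.norm_real, Real.norm_of_nonneg h4.1.le] at h6
    have h7 := (sq_eq_sq₀ h4.1.le hd0pos.le).mp h6
    rw [h7] at h5
    exact h5
  have circ : ∀ (A : LBfiber (k + 1) Ξ) i, a A i 0 / (√(wt μ l i) : ℂ) ∈ Submonoid.unitSphere ℂ := by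
    intro A i
    refine mem_sphere_zero_iff_norm.mpr ?_
    rw [norm_div, Complex.norm_real, Real.norm_of_nonneg (hsw i).le,
      ← (core A).1 i, Real.sqrt_sq (norm_nonneg _), div_self]
    intro h0
    have := (core A).1 i
    rw [h0] at this
    have := hw i
    simp_all
  let vec : (Fin k → Circle) → Matrix (Fin k) (Fin 1) ℂ :=
    fun θ => of fun i _ => (√(wt μ l i) : ℂ) * (θ i : ℂ)
  have cvec : Continuous vec := continuous_matrix fun i _ =>
    continuous_const.mul (continuous_subtype_val.comp (continuous_apply i))
  let bb : LBfiber k Ξ × (Fin k → Circle) → Matrix (Fin k) (Fin 1) ℂ :=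
    fun x => (x.1.1 * U x.1 * diagonal (fun i => ((μ i : ℂ))⁻¹)) * vec x.2
  have cbb : Continuous bb :=
    (((continuous_subtype_val.comp continuous_fst).matrix_mul (cU.comp continuous_fst)).matrix_mul
      continuous_const).matrix_mul (cvec.comp continuous_snd)
  have hbb : ∀ x, (x.1.1 * U x.1)ᴴ * bb x = vec x.2 := by
    intro x
    simp only [bb]
    rw [← Matrix.mul_assoc, (hU x.1).inv' hμ, Matrix.one_mul]
  have memb : ∀ x : LBfiber k Ξ × (Fin k → Circle), bord x.1.1 (bb x) D0 ∈ LBfiber (k + 1) Ξ := by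
    intro x
    rw [h.mem_succ hk, tl_bord, bord_charpoly,
      core_iff (hU x.1) (h.charpoly hk.le x.1.2) hinj hμ]
    refine ⟨bord_mem x.1.2.1 _ _ (by simpa [D0] using hd0pos), x.1.2, ?_, ?_⟩
    · intro i
      rw [hbb]
      simp only [vec, of_apply, norm_mul, Circle.norm_coe, mul_one, Complex.norm_real]
      rw [Real.norm_of_nonneg (hsw i).le, Real.sq_sqrt (hw i).le]
    · simp only [D0, of_apply, Complex.norm_real, Real.norm_of_nonneg hd0pos.le]
      exact hd0sq
  refine ⟨⟨⟨fun A => (T A, fun i => ⟨a A i 0 / (√(wt μ l i) : ℂ), circ A i⟩),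
    fun x => ⟨bord x.1.1 (bb x) D0, memb x⟩, ?_, ?_⟩, ?_, ?_⟩⟩
  · intro A
    apply Subtype.ext
    conv_rhs => rw [← bord_eq (fib A).1, (core A).2]
    change bord (tl A.1) _ D0 = _
    congr 1
    have e : vec (fun i => ⟨a A i 0 / (√(wt μ l i) : ℂ), circ A i⟩) = a A := by
      ext i j
      obtain rfl : j = 0 := Subsingleton.elim _ _
      have : (√(wt μ l i) : ℂ) ≠ 0 := by exact_mod_cast (hsw i).ne'
      change (√(wt μ l i) : ℂ) * (a A i 0 / (√(wt μ l i) : ℂ)) = _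
      field_simp
    simp only [bb]
    rw [e]
    simp only [a]
    rw [← Matrix.mul_assoc, Matrix.mul_assoc _ _ ((T A).1 * U (T A))ᴴ, (hU (T A)).inv hμ,
      Matrix.one_mul]
  · intro x
    have hT : T ⟨bord x.1.1 (bb x) D0, memb x⟩ = x.1 := Subtype.ext (tl_bord _ _ _)
    refine Prod.ext hT ?_
    funext i
    apply Subtype.ext
    change a ⟨bord x.1.1 (bb x) D0, memb x⟩ i 0 / (√(wt μ l i) : ℂ) = (x.2 i : ℂ)
    have : (√(wt μ l i) : ℂ) ≠ 0 := by exact_mod_cast (hsw i).ne'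
    simp only [a]
    rw [hT, colb_bord, hbb]
    simp only [vec, of_apply]
    field_simp
  · refine cT.prodMk (continuous_pi fun i => ?_)
    exact Continuous.subtype_mk ((ca.matrix_elem i 0).div_const _) _
  · exact (continuous_bord (continuous_subtype_val.comp continuous_fst) cbb).subtype_mk _

theorem tri_succ (k : ℕ) : k * (k - 1) / 2 + k = (k + 1) * (k + 1 - 1) / 2 := by
  rw [Nat.add_sub_cancel, ← Nat.choose_two_right]
  have := Nat.choose_two_right (k + 1)
  rw [Nat.add_sub_cancel] at this
  rw [← this, Nat.choose_succ_succ' k 1, Nat.choose_one_right, add_comm]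

theorem main {n : ℕ} {Ξ : ℕ → ℕ → ℝ} (h : Hyp n Ξ) : ∀ k ≤ n,
    Nonempty (LBfiber k Ξ ≃ₜ (Fin (k * (k - 1) / 2) → Circle)) := by
  intro k
  induction k with
  | zero =>
    intro _
    have h1 : (0 : Matrix (Fin 0) (Fin 0) ℂ) ∈ LBfiber 0 Ξ := by
      refine ⟨⟨fun i => i.elim0, fun i => i.elim0⟩, fun k i hik hk => ?_⟩
      obtain rfl : k = 0 := by omega
      obtain rfl : i = 0 := by omega
      rw [h.h0 0 (Nat.zero_le _)]; unfold LBtab; rw [dif_neg (by omega)]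
    have : Unique (LBfiber 0 Ξ) := ⟨⟨⟨0, h1⟩⟩, fun x => Subtype.ext (Subsingleton.elim _ _)⟩
    have : Unique (Fin (0 * (0 - 1) / 2) → Circle) := by
      rw [Nat.zero_mul, Nat.zero_div]; infer_instance
    exact ⟨Homeomorph.homeomorphOfUnique _ _⟩
  | succ k ih =>
    intro hk
    obtain ⟨e1⟩ := ih (by omega)
    obtain ⟨e2⟩ := step h (k := k) hk
    refine ⟨e2.trans ((e1.prodCongr (Homeomorph.refl _)).trans
      (Homeomorph.sumArrowHomeomorphProdArrow.symm.trans ?_))⟩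
    exact Homeomorph.piCongrLeft (Y := fun _ => Circle)
      (finSumFinEquiv.trans (finCongr (tri_succ k)))

end GZ

/-- For `Ξ` an interior point of the Gelfand–Zeitlin cone (all interlacing
inequalities strict), the fiber `L_B⁻¹(Ξ)` is homeomorphic to the torus
`(S¹)^{n(n-1)/2}`. -/
theorem fiber_LB_interior_homeomorphic_maximal_torus (n : ℕ) (hn : 0 < n)
    (Ξ : ℕ → ℕ → ℝ)
    (h0 : ∀ k ≤ n, Ξ k 0 = 0)
    (hstrict : ∀ k i : ℕ, 1 ≤ i → i ≤ k → k < n →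
      Ξ (k + 1) i + Ξ k (i - 1) > Ξ (k + 1) (i - 1) + Ξ k i ∧
      Ξ (k + 1) i + Ξ k i > Ξ (k + 1) (i + 1) + Ξ k (i - 1)) :
    Nonempty ((LBfiber n Ξ) ≃ₜ (Fin (n * (n - 1) / 2) → Circle)) := by
  exact GZ.main ⟨h0, hstrict⟩ n le_rfl
end
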